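/- arXiv:2505.04039 — 2 statements merged into one kernel-verified Lean document; each statement's English description precedes it below -/
import Mathlib

section
/- For every integer s ≥ 1, the Dwork congruence holds at q = 1: p^s divides T_{s+1}(z,1)·T_{s−1}(z^p,1) − T_s(z,1)·T_s(z^p,1) in ℤ[z]. (Equivalently, T_{s+1}(z,1)/T_s(z^p,1) ≡ T_s(z,1)/T_{s−1}(z^p,1) mod p^s.) -/
open MvPolynomial Finset

/-- Dimension vector of the framed `A_{n-1}` quiver: `v i = min(i, k, n - i)`. -/
def dimv (k n i : ℕ) : ℕ := min i (min k (n - i))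

/-- `c_s = (p^s - 1)·ω` where `ω = r₀/q₀` (an integer under the standing hypotheses). -/
def cExp (p r₀ q₀ s : ℕ) : ℕ := (p ^ s - 1) * r₀ / q₀

/-- `a_s = (p^s - 1)·(1 - ω)`. -/
def aExp (p r₀ q₀ s : ℕ) : ℕ := (p ^ s - 1) - cExp p r₀ q₀ s

/-- `b_s = (p^s - 1)·(1 - 2ω)/2`. -/
def bExp (p r₀ q₀ s : ℕ) : ℕ := (p ^ s - 1 - 2 * cExp p r₀ q₀ s) / 2

/-- The coefficient ring `ℤ[z,q]`, with `z = X false` and `q = X true`. -/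
abbrev Zq : Type := MvPolynomial Bool ℤ

noncomputable def Zvar : Zq := MvPolynomial.X false
noncomputable def Qvar : Zq := MvPolynomial.X true

/-- The superpotential factor `Φ̄_s(x, z, q)`, a polynomial in the variables
`x_{i,j}` (indexed by pairs `(i,j) : ℕ × ℕ`) with coefficients in `ℤ[z,q]`. -/
noncomputable def Phibar (p r₀ q₀ k n s : ℕ) : MvPolynomial (ℕ × ℕ) Zq :=
  (∏ m ∈ Icc 1 (n - 1), ∏ j ∈ Icc 1 (dimv k n m), X (m, j)) ^ aExp p r₀ q₀ s *
  (∏ m ∈ Icc 1 (n - 1),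
    ∏ ij ∈ ((Icc 1 (dimv k n m)) ×ˢ (Icc 1 (dimv k n m))).filter (fun ij => ij.1 ≠ ij.2),
      ∏ r ∈ range (bExp p r₀ q₀ s), (X (m, ij.1) - C (Qvar ^ r) * X (m, ij.2))) *
  (∏ i ∈ Icc 1 (n - 2), ∏ a ∈ Icc 1 (dimv k n i), ∏ b ∈ Icc 1 (dimv k n (i + 1)),
      ∏ r ∈ range (cExp p r₀ q₀ s), (X (i, a) - C (Qvar ^ r) * X (i + 1, b))) *
  (∏ i ∈ Icc 1 k, ∏ r ∈ range (cExp p r₀ q₀ s),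
      (C Zvar - C (Qvar ^ r) * X (k, i)) * (1 - C (Qvar ^ r) * X (n - k, i)))

/-- The Vandermonde factor `Δ(x)`. -/
noncomputable def Vand (k n : ℕ) : MvPolynomial (ℕ × ℕ) Zq :=
  ∏ m ∈ Icc 1 (n - 1),
    ∏ ij ∈ ((Icc 1 (dimv k n m)) ×ˢ (Icc 1 (dimv k n m))).filter (fun ij => ij.1 < ij.2),
      (X (m, ij.2) - X (m, ij.1))

/-- `Φ_s = Δ · Φ̄_s`. -/
noncomputable def Phi (p r₀ q₀ k n s : ℕ) : MvPolynomial (ℕ × ℕ) Zq :=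
  Vand k n * Phibar p r₀ q₀ k n s

/-- Exponent vector of the monomial `∏_{i,j} x_{i,j}^{j·p^s - 1}`. -/
noncomputable def expVec (p k n s : ℕ) : (ℕ × ℕ) →₀ ℕ :=
  ∑ i ∈ Icc 1 (n - 1), ∑ j ∈ Icc 1 (dimv k n i), Finsupp.single (i, j) (j * p ^ s - 1)

/-- The truncation `T_s(z,q) ∈ ℤ[z,q]` of the K-theoretic vertex function of
`T*Gr(k,n)`: the coefficient of `∏ x_{i,j}^{j·p^s - 1}` in `Φ_s(x,z,q)`. -/
noncomputable def Ts (p r₀ q₀ k n s : ℕ) : Zq :=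
  MvPolynomial.coeff (expVec p k n s) (Phi p r₀ q₀ k n s)

/-- Evaluation `ℤ[z,q] → ℤ[z]` sending `q ↦ 1` and `z ↦ z^e`. -/
noncomputable def evalQOne (e : ℕ) : Zq →+* Polynomial ℤ :=
  MvPolynomial.eval₂Hom (Int.castRingHom (Polynomial ℤ))
    (fun b => bif b then 1 else Polynomial.X ^ e)

section FrobeniusLift

variable {R : Type*} [CommRing R]

lemma RingHom.pow_add_apply (φ : R →+* R) (a b : ℕ) (x : R) :
    (φ ^ (a + b)) x = (φ ^ a) ((φ ^ b) x) := by
  rw [pow_add]; rfl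

/-- A sequence `T` with a recursion `T_{s+1} = ∑ c_j φ^{j+1}(T_{s-j})`, whose coefficients satisfy
`p ^ j ∣ c_j`, satisfies the generalized Dwork congruences. -/
theorem dwork_congruence_of_recursion (p : ℕ) (φ : R →+* R) (T c : ℕ → R)
    (hT : ∀ s, T (s + 1) = ∑ j ∈ range (s + 1), c j * (φ ^ (j + 1)) (T (s - j)))
    (hc : ∀ j, (p : R) ^ j ∣ c j) (N i l : ℕ) (hN : i + l = N) :
    (p : R) ^ (l + 1) ∣ T (i + l + 1) * (φ ^ i) (T l) - T (i + l) * (φ ^ i) (T (l + 1)) := by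
  induction N using Nat.strong_induction_on generalizing i l with
  | _ N ih =>
  obtain rfl | hi := Nat.eq_zero_or_pos i
  · simp [mul_comm]
  have hmap (j e : ℕ) (x : R) (h : (p : R) ^ e ∣ x) : (p : R) ^ e ∣ (φ ^ j) x := by
    have h' := map_dvd (φ ^ j) h
    rwa [map_pow, map_natCast] at h'
  obtain ⟨m, hm⟩ : ∃ m, i + l = m + 1 := ⟨i + l - 1, by omega⟩
  have key : T (i + l + 1) * (φ ^ i) (T l) - T (i + l) * (φ ^ i) (T (l + 1)) =
      ∑ j ∈ range (m + 1), c j * ((φ ^ (j + 1)) (T (m + 1 - j)) * (φ ^ i) (T l) -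
        (φ ^ (j + 1)) (T (m - j)) * (φ ^ i) (T (l + 1))) +
      c (m + 1) * (φ ^ (m + 2)) (T 0) * (φ ^ i) (T l) := by
    rw [hm, hT (m + 1), hT m, sum_range_succ, add_mul, sum_mul, sum_mul, add_sub_right_comm,
      ← sum_sub_distrib, Nat.sub_self]
    congr 1
    exact sum_congr rfl fun j _ => by ring
  rw [key]
  refine dvd_add (dvd_sum fun j hj => ?_) ?_
  · rw [mem_range] at hj
    rcases le_or_gt (j + 1) i with hji | hji
    · obtain ⟨i', rfl⟩ := Nat.exists_eq_add_of_le hji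
      have h := hmap (j + 1) _ _ (ih (i' + l) (by omega) i' l rfl)
      rw [map_sub, map_mul, map_mul, ← RingHom.pow_add_apply, ← RingHom.pow_add_apply] at h
      have e1 : m + 1 - j = i' + l + 1 := by omega
      have e2 : m - j = i' + l := by omega
      rw [e1, e2]
      exact h.mul_left _
    · obtain ⟨d, hd⟩ := Nat.exists_eq_add_of_le hji.le
      obtain ⟨l', rfl⟩ := Nat.exists_eq_add_of_le (show d ≤ l by omega)
      have h := hmap i _ _ (ih (d + l') (by omega) d l' rfl)
      rw [map_sub, map_mul, map_mul, ← RingHom.pow_add_apply, ← RingHom.pow_add_apply, ← hd] at h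
      have e1 : m + 1 - j = l' + 1 := by omega
      have e2 : m - j = l' := by omega
      rw [e1, e2, dvd_sub_comm] at *
      have h2 := mul_dvd_mul (hc j) h
      rw [← pow_add] at h2
      refine (pow_dvd_pow _ ?_).trans (h2.trans (dvd_of_eq ?_))
      · omega
      · ring
  · refine Dvd.dvd.mul_right (Dvd.dvd.mul_right ((pow_dvd_pow _ ?_).trans (hc _)) _) _
    omega

/-- The product `∏_{i < s} Λ ^ (p ^ i)`. -/
def frobProd (p : ℕ) (Λ : R) (s : ℕ) : R := Λ ^ ∑ i ∈ range s, p ^ i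

lemma frobProd_succ (p : ℕ) (Λ : R) (s : ℕ) :
    frobProd p Λ (s + 1) = frobProd p Λ s * Λ ^ p ^ s := by
  simp [frobProd, sum_range_succ, pow_add]

/-- The ghost terms of `Λ`, defined by the recursion `frobProd_succ_eq_sum_ghost`. -/
def ghost (p : ℕ) (φ : R →+* R) (Λ : R) (s : ℕ) : R :=
  frobProd p Λ (s + 1) -
    ∑ j : Fin s, ghost p φ Λ j * (φ ^ (j.1 + 1)) (frobProd p Λ (s - j))
termination_by s
decreasing_by exact j.2

lemma ghost_eq (p : ℕ) (φ : R →+* R) (Λ : R) (s : ℕ) :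
    ghost p φ Λ s = frobProd p Λ (s + 1) -
      ∑ j ∈ range s, ghost p φ Λ j * (φ ^ (j + 1)) (frobProd p Λ (s - j)) := by
  rw [ghost, Finset.sum_range]

lemma frobProd_succ_eq_sum_ghost (p : ℕ) (φ : R →+* R) (Λ : R) (s : ℕ) :
    frobProd p Λ (s + 1) =
      ∑ j ∈ range (s + 1), ghost p φ Λ j * (φ ^ (j + 1)) (frobProd p Λ (s - j)) := by
  rw [sum_range_succ, ghost_eq p φ Λ s]
  simp [frobProd]

lemma dvd_pow_sub_iterate {p : ℕ} {φ : R →+* R} (hφ : ∀ a, (p : R) ∣ φ a - a ^ p) (a : R)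
    (j : ℕ) : (p : R) ∣ a ^ p ^ j - (φ ^ j) a := by
  induction j generalizing a with
  | zero => simp
  | succ j ih =>
    have h1 : (p : R) ∣ a ^ p ^ (j + 1) - (φ ^ j) (a ^ p) := by
      rw [pow_succ', pow_mul]; exact ih _
    have h2 : (p : R) ∣ (φ ^ j) (φ a - a ^ p) := by simpa using map_dvd (φ ^ j) (hφ a)
    have h3 := dvd_sub h1 h2
    rw [map_sub] at h3
    have h4 : (φ ^ (j + 1)) a = (φ ^ j) (φ a) := by rw [RingHom.pow_add_apply, pow_one]
    rw [h4]
    convert h3 using 1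
    ring

/-- The ghost terms are divisible by increasing powers of `p`. -/
theorem pow_dvd_ghost {p : ℕ} {φ : R →+* R} (hφ : ∀ a, (p : R) ∣ φ a - a ^ p) (Λ : R) (s : ℕ) :
    (p : R) ^ s ∣ ghost p φ Λ s := by
  induction s using Nat.strong_induction_on with
  | _ s ih =>
  obtain _ | s := s
  · simp
  have key : ghost p φ Λ (s + 1) = ∑ j ∈ range (s + 1), ghost p φ Λ j *
      ((φ ^ (j + 1)) (frobProd p Λ (s - j)) *
        ((Λ ^ p ^ (j + 1)) ^ p ^ (s - j) - ((φ ^ (j + 1)) Λ) ^ p ^ (s - j))) := by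
    rw [ghost_eq, frobProd_succ, frobProd_succ_eq_sum_ghost p φ, sum_mul, ← sum_sub_distrib]
    refine sum_congr rfl fun j hj => ?_
    rw [mem_range] at hj
    rw [show s + 1 - j = s - j + 1 by omega, frobProd_succ, map_mul, map_pow, ← pow_mul Λ,
      ← pow_add p, show j + 1 + (s - j) = s + 1 by omega]
    ring
  rw [key]
  refine dvd_sum fun j hj => ?_
  rw [mem_range] at hj
  rw [show s + 1 = j + (s - j + 1) by omega, pow_add]
  exact mul_dvd_mul (ih j hj) ((dvd_sub_pow_of_dvd_sub (dvd_pow_sub_iterate hφ Λ _) _).mul_left _)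

end FrobeniusLift

section FrobeniusMvPolynomial

variable {σ R : Type*} [CommRing R]

lemma dvd_add_lift {p : ℕ} (hp : p.Prime) {ψ : R →+* R} {a b : R}
    (ha : (p : R) ∣ ψ a - a ^ p) (hb : (p : R) ∣ ψ b - b ^ p) :
    (p : R) ∣ ψ (a + b) - (a + b) ^ p := by
  obtain ⟨r, hr⟩ := exists_add_pow_prime_eq hp a b
  have : ψ (a + b) - (a + b) ^ p = (ψ a - a ^ p) + (ψ b - b ^ p) - p * (a * b * r) := by
    rw [hr, map_add]; ring
  rw [this]
  exact dvd_sub (dvd_add ha hb) (dvd_mul_right _ _)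

lemma dvd_mul_lift {p : ℕ} {ψ : R →+* R} {a b : R}
    (ha : (p : R) ∣ ψ a - a ^ p) (hb : (p : R) ∣ ψ b - b ^ p) :
    (p : R) ∣ ψ (a * b) - (a * b) ^ p := by
  have : ψ (a * b) - (a * b) ^ p = (ψ a - a ^ p) * ψ b + a ^ p * (ψ b - b ^ p) := by
    rw [map_mul]; ring
  rw [this]
  exact dvd_add (ha.mul_right _) (hb.mul_left _)

/-- The ring endomorphism raising variables to the power `p` and acting by `ψ` on coefficients. -/
noncomputable def frobMv (p : ℕ) (ψ : R →+* R) : MvPolynomial σ R →+* MvPolynomial σ R :=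
  (expand p : MvPolynomial σ R →ₐ[R] MvPolynomial σ R).toRingHom.comp (map ψ)

lemma frobMv_apply (p : ℕ) (ψ : R →+* R) (f : MvPolynomial σ R) :
    frobMv p ψ f = expand p (map ψ f) := rfl

lemma frobMv_pow_apply (p : ℕ) (ψ : R →+* R) (j : ℕ) (f : MvPolynomial σ R) :
    (frobMv p ψ ^ j) f = expand (p ^ j) (map (ψ ^ j) f) := by
  induction j with
  | zero => simp [RingHom.one_def, MvPolynomial.map_id]
  | succ j ih =>
    rw [add_comm, RingHom.pow_add_apply, ih, pow_one, frobMv_apply, map_expand, MvPolynomial.map_map,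
      ← expand_mul, pow_add p, pow_add ψ, pow_one, pow_one]
    rfl

lemma dvd_frobMv_sub_pow {p : ℕ} (hp : p.Prime) {ψ : R →+* R}
    (hψ : ∀ a, (p : R) ∣ ψ a - a ^ p) (f : MvPolynomial σ R) :
    (p : MvPolynomial σ R) ∣ frobMv p ψ f - f ^ p := by
  induction f using MvPolynomial.induction_on with
  | C a =>
    have := map_dvd (C : R →+* MvPolynomial σ R) (hψ a)
    simpa [frobMv_apply] using this
  | add f g hf hg => exact dvd_add_lift hp hf hg
  | mul_X f i hf => exact dvd_mul_lift hf (by simp [frobMv_apply])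

lemma coeff_mul_expand {q : ℕ} (hq : 0 < q) {f Δ : MvPolynomial σ R} {c : R}
    (H : ∀ w, coeff (q • w) f = c * coeff w Δ) (h : MvPolynomial σ R) (u : σ →₀ ℕ) :
    coeff (q • u) (f * expand q h) = c * coeff u (Δ * h) := by
  induction h using MvPolynomial.induction_on' with
  | monomial v a =>
    have hle : q • v ≤ q • u ↔ v ≤ u := by
      simp only [Finsupp.le_def, Finsupp.smul_apply, smul_eq_mul, Nat.mul_le_mul_left_iff hq]
    have hsub : q • u - q • v = q • (u - v) := by
      ext e; simp [Nat.mul_sub]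
    rw [expand_monomial, coeff_mul_monomial', coeff_mul_monomial', if_congr hle rfl rfl, hsub, H]
    split_ifs <;> ring
  | add h₁ h₂ ih₁ ih₂ => simp only [map_add, mul_add, coeff_add, ih₁, ih₂]

/-- Dwork congruence for coefficients of `Δ * Λ ^ (1 + p + ⋯ + p ^ (s - 1))`, when the coefficients
of `Δ * ghost Λ` at multiples of `p ^ (j + 1)` are proportional to those of `Δ`. -/
theorem dwork_congruence_coeff {p : ℕ} (hp : p.Prime) {ψ : R →+* R}
    (hψ : ∀ a, (p : R) ∣ ψ a - a ^ p) {Δ Λ : MvPolynomial σ R} (hΔ : map ψ Δ = Δ) (J : σ →₀ ℕ)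
    (H : ∀ j w, coeff (p ^ (j + 1) • w) (Δ * ghost p (frobMv p ψ) Λ j) =
      coeff (p ^ (j + 1) • J) (Δ * ghost p (frobMv p ψ) Λ j) * coeff w Δ)
    (T : ℕ → R) (hT : ∀ s, T s = coeff (p ^ s • J) (Δ * frobProd p Λ s)) (s : ℕ) (hs : 1 ≤ s) :
    (p : R) ^ s ∣ T (s + 1) * ψ (T (s - 1)) - T s * ψ (T s) := by
  have hΔj (j : ℕ) : map (ψ ^ j) Δ = Δ := by
    induction j with
    | zero => simp [RingHom.one_def, MvPolynomial.map_id]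
    | succ j ih =>
      have := MvPolynomial.map_map ψ (ψ ^ j) Δ
      rw [hΔ, ih] at this
      rw [pow_succ]; exact this.symm
  have hrec (s : ℕ) : T (s + 1) = ∑ j ∈ range (s + 1),
      coeff (p ^ (j + 1) • J) (Δ * ghost p (frobMv p ψ) Λ j) * (ψ ^ (j + 1)) (T (s - j)) := by
    rw [hT, frobProd_succ_eq_sum_ghost p (frobMv p ψ), mul_sum, coeff_sum]
    refine sum_congr rfl fun j hj => ?_
    rw [mem_range] at hj
    rw [← mul_assoc, frobMv_pow_apply, show s + 1 = (j + 1) + (s - j) by omega, pow_add, mul_smul,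
      coeff_mul_expand (pow_pos hp.pos _) (H j), hT, ← coeff_map, map_mul, hΔj]
  have hdvd (j : ℕ) :
      (p : R) ^ j ∣ coeff (p ^ (j + 1) • J) (Δ * ghost p (frobMv p ψ) Λ j) := by
    have h := (pow_dvd_ghost (dvd_frobMv_sub_pow hp hψ) Λ j).mul_left Δ
    obtain ⟨g, hg⟩ := h
    rw [hg, ← map_natCast (C : R →+* MvPolynomial σ R) p, ← map_pow, coeff_C_mul]
    exact dvd_mul_right _ _
  obtain ⟨l, rfl⟩ := Nat.exists_eq_add_of_le' hs
  have := dwork_congruence_of_recursion p ψ T _ hrec hdvd (1 + l) 1 l rfl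
  rwa [pow_one, add_comm 1 l] at this

end FrobeniusMvPolynomial

section GhostInvariants

variable {σ R : Type*} [CommRing R]

lemma rename_ghost {p : ℕ} {ψ : R →+* R} {Λ : MvPolynomial σ R} {τ : σ → σ}
    (hτ : rename τ Λ = Λ) (s : ℕ) :
    rename τ (ghost p (frobMv p ψ) Λ s) = ghost p (frobMv p ψ) Λ s := by
  have hP (t : ℕ) : rename τ (frobProd p Λ t) = frobProd p Λ t := by
    simp only [frobProd, map_pow, hτ]
  induction s using Nat.strong_induction_on with
  | _ s ih =>
  rw [ghost_eq, map_sub, hP, map_sum]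
  congr 1
  refine sum_congr rfl fun j hj => ?_
  rw [map_mul, ih j (mem_range.mp hj), frobMv_pow_apply, rename_expand, ← map_rename, hP]

lemma degreeOf_expand_le (q : ℕ) (f : MvPolynomial σ R) (e : σ) :
    degreeOf e (expand q f) ≤ q * degreeOf e f := by
  classical
  rw [degreeOf_le_iff]
  intro m hm
  obtain ⟨u, hu, rfl⟩ := mem_image.mp (support_expand_subset f hm)
  simpa using Nat.mul_le_mul_left q (monomial_le_degreeOf e hu)

lemma degreeOf_map_coeff_le (ψ : R →+* R) (f : MvPolynomial σ R) (e : σ) :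
    degreeOf e (MvPolynomial.map ψ f) ≤ degreeOf e f := by
  rw [degreeOf_le_iff]
  exact fun m hm => monomial_le_degreeOf e (support_map_subset _ _ hm)

lemma degreeOf_ghost_le {p : ℕ} {ψ : R →+* R} {Λ : MvPolynomial σ R} {e : σ} {D : ℕ}
    (hD : degreeOf e Λ ≤ D) (s : ℕ) :
    degreeOf e (ghost p (frobMv p ψ) Λ s) ≤ (∑ i ∈ range (s + 1), p ^ i) * D := by
  have hP (t : ℕ) : degreeOf e (frobProd p Λ t) ≤ (∑ i ∈ range t, p ^ i) * D :=
    (degreeOf_pow_le _ _ _).trans (Nat.mul_le_mul_left _ hD)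
  induction s using Nat.strong_induction_on with
  | _ s ih =>
  rw [ghost_eq]
  refine (degreeOf_sub_le _ _ _).trans (max_le (hP _) ?_)
  refine (degreeOf_sum_le _ _ _).trans (Finset.sup_le fun j hj => ?_)
  rw [mem_range] at hj
  refine (degreeOf_mul_le _ _ _).trans ?_
  rw [frobMv_pow_apply]
  have h1 := (degreeOf_expand_le (p ^ (j + 1)) (MvPolynomial.map (ψ ^ (j + 1))
    (frobProd p Λ (s - j))) e).trans
      (Nat.mul_le_mul_left _ ((degreeOf_map_coeff_le _ _ _).trans (hP (s - j))))
  refine (add_le_add (ih j hj) h1).trans (le_of_eq ?_)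
  rw [show s + 1 = (j + 1) + (s - j) by omega, sum_range_add _ (j + 1), add_mul, ← mul_assoc,
    mul_sum]
  simp only [pow_add]

end GhostInvariants

section Rigidity

/-- The index set `{(m, j) : m ∈ M, 1 ≤ j ≤ v m}`. -/
def blockIdx (M : Finset ℕ) (v : ℕ → ℕ) : Finset (ℕ × ℕ) :=
  (M.sigma fun m => Icc 1 (v m)).map (Equiv.sigmaEquivProd ℕ ℕ).toEmbedding

lemma mem_blockIdx {M : Finset ℕ} {v : ℕ → ℕ} {e : ℕ × ℕ} :
    e ∈ blockIdx M v ↔ e.1 ∈ M ∧ 1 ≤ e.2 ∧ e.2 ≤ v e.1 := by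
  simp [blockIdx, Finset.mem_map_equiv]

lemma prod_blockIdx {A : Type*} [CommMonoid A] (M : Finset ℕ) (v : ℕ → ℕ) (f : ℕ × ℕ → A) :
    ∏ e ∈ blockIdx M v, f e = ∏ m ∈ M, ∏ j ∈ Icc 1 (v m), f (m, j) := by
  simp [blockIdx, Finset.prod_map, Finset.prod_sigma]

/-- The exponent vector with entry `j` at each index `(m, j)` of the blocks. -/
noncomputable def stairs (M : Finset ℕ) (v : ℕ → ℕ) : ℕ × ℕ →₀ ℕ :=
  Finsupp.indicator (blockIdx M v) fun e _ => e.2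

lemma stairs_apply (M : Finset ℕ) (v : ℕ → ℕ) (e : ℕ × ℕ) :
    stairs M v e = if e ∈ blockIdx M v then e.2 else 0 := by
  simp [stairs, Finsupp.indicator_apply]

lemma mapDomain_swap_apply {α : Type*} [DecidableEq α] (a b e : α) (w : α →₀ ℕ) :
    Finsupp.mapDomain (Equiv.swap a b) w e = w (Equiv.swap a b e) := by
  conv_lhs => rw [← Equiv.swap_apply_self a b e]
  exact Finsupp.mapDomain_apply (Equiv.injective _) _ _

/-- A function on exponent vectors which is antisymmetric in each block and supported on vectors
with entries in `[1, v m]` on the block `m` is determined by its value at `stairs M v`. -/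
theorem eq_zero_of_antisymm {R : Type*} [CommRing R] [IsDomain R] [CharZero R]
    {M : Finset ℕ} {v : ℕ → ℕ} {K : (ℕ × ℕ →₀ ℕ) → R}
    (hin : ∀ w, K w ≠ 0 → ∀ e ∈ blockIdx M v, 1 ≤ w e ∧ w e ≤ v e.1)
    (hout : ∀ w, K w ≠ 0 → ∀ e ∉ blockIdx M v, w e = 0)
    (hanti : ∀ m i j, (m, i) ∈ blockIdx M v → (m, j) ∈ blockIdx M v → i ≠ j → ∀ w,
      K (Finsupp.mapDomain (Equiv.swap (m, i) (m, j)) w) = - K w)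
    (hJ : K (stairs M v) = 0) (w : ℕ × ℕ →₀ ℕ) : K w = 0 := by
  by_contra hw
  induction hN : #{e ∈ blockIdx M v | w e ≠ e.2} using Nat.strong_induction_on generalizing w with
  | _ N ih =>
  by_cases hst : ∀ e ∈ blockIdx M v, w e = e.2
  · apply hw
    rw [← hJ]
    congr 1
    ext e
    rw [stairs_apply]
    split_ifs with he
    · exact hst e he
    · exact hout w hw e he
  · push Not at hst
    obtain ⟨⟨m, j⟩, he, hne⟩ := hst
    set l := w (m, j) with hl
    have hlI : (m, l) ∈ blockIdx M v := by
      rw [mem_blockIdx] at he ⊢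
      exact ⟨he.1, hin w hw (m, j) (mem_blockIdx.mpr he)⟩
    have hjl : j ≠ l := fun h => hne h.symm
    have hinj : w (m, l) ≠ l := by
      intro h
      have h1 := hanti m j l he hlI hjl w
      have h2 : Finsupp.mapDomain (Equiv.swap (m, j) (m, l)) w = w := by
        ext e
        rw [mapDomain_swap_apply, Equiv.swap_apply_def]
        split_ifs with h1 h2
        · rw [h1, h, hl]
        · rw [h2, h, hl]
        · rfl
      rw [h2] at h1
      exact hw (self_eq_neg.mp h1)
    refine ih _ ?_ (Finsupp.mapDomain (Equiv.swap (m, j) (m, l)) w) ?_ rfl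
    · rw [← hN]
      apply card_lt_card
      rw [Finset.ssubset_iff_of_subset]
      · refine ⟨(m, l), by simp [hlI, hinj], ?_⟩
        simp [← hl]
      · intro e
        simp only [mem_filter, mapDomain_swap_apply]
        rintro ⟨h1, h2⟩
        refine ⟨h1, ?_⟩
        rw [Equiv.swap_apply_def] at h2
        split_ifs at h2 with h3 h4
        · subst h3; exact hne
        · subst h4; exact hinj
        · exact h2
    · rw [hanti m j l he hlI hjl]
      simpa using hw

variable {R : Type*} [CommRing R]

lemma coeff_mapDomain_of_rename_eq_neg {σ : Type*} {τ : Equiv.Perm σ} {f : MvPolynomial σ R}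
    (h : rename τ f = -f) (u : σ →₀ ℕ) : coeff (Finsupp.mapDomain τ u) f = - coeff u f := by
  rw [← coeff_rename_mapDomain τ τ.injective f u, h, coeff_neg, neg_neg]

/-- The conditions on a polynomial `f` under which its coefficients at multiples of `q` are those
of an antisymmetric polynomial of small degree. -/
structure BlockAntisymm (M : Finset ℕ) (v : ℕ → ℕ) (q : ℕ) (f : MvPolynomial (ℕ × ℕ) R) :
    Prop where
  dvd : ∀ e ∈ blockIdx M v, X e ∣ f
  degree_lt : ∀ e ∈ blockIdx M v, degreeOf e f < q * (v e.1 + 1)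
  degree_eq : ∀ e ∉ blockIdx M v, degreeOf e f = 0
  antisymm : ∀ m i j, (m, i) ∈ blockIdx M v → (m, j) ∈ blockIdx M v → i ≠ j →
    rename (Equiv.swap (m, i) (m, j)) f = -f

namespace BlockAntisymm

variable {M : Finset ℕ} {v : ℕ → ℕ} {q : ℕ} {f : MvPolynomial (ℕ × ℕ) R}

lemma exponent_mem (hf : BlockAntisymm M v q f) {w : ℕ × ℕ →₀ ℕ} (hw : coeff (q • w) f ≠ 0)
    {e : ℕ × ℕ} (he : e ∈ blockIdx M v) : 1 ≤ w e ∧ w e ≤ v e.1 := by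
  constructor
  · obtain ⟨g, hg⟩ := hf.dvd e he
    rw [hg, coeff_X_mul'] at hw
    by_contra h
    exact hw (if_neg (by simp [show w e = 0 by omega]))
  · have h1 := monomial_le_degreeOf e (mem_support_iff.mpr hw)
    have h2 := h1.trans_lt (hf.degree_lt e he)
    rw [Finsupp.smul_apply, smul_eq_mul] at h2
    exact Nat.lt_succ_iff.mp (Nat.lt_of_mul_lt_mul_left h2)

lemma exponent_eq_zero (hf : BlockAntisymm M v q f) (hq : 0 < q) {w : ℕ × ℕ →₀ ℕ}
    (hw : coeff (q • w) f ≠ 0) {e : ℕ × ℕ} (he : e ∉ blockIdx M v) : w e = 0 := by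
  have h1 := monomial_le_degreeOf e (mem_support_iff.mpr hw)
  rw [hf.degree_eq e he, Finsupp.smul_apply, smul_eq_mul] at h1
  exact (Nat.mul_eq_zero.mp (Nat.le_zero.mp h1)).resolve_left hq.ne'

lemma coeff_swap (hf : BlockAntisymm M v q f) {m i j : ℕ} (hi : (m, i) ∈ blockIdx M v)
    (hj : (m, j) ∈ blockIdx M v) (hij : i ≠ j) (w : ℕ × ℕ →₀ ℕ) :
    coeff (q • Finsupp.mapDomain (Equiv.swap (m, i) (m, j)) w) f = - coeff (q • w) f := by
  rw [← Finsupp.mapDomain_smul]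
  exact coeff_mapDomain_of_rename_eq_neg (hf.antisymm m i j hi hj hij) _

/-- The coefficients at multiples of `q` are proportional to those of an antisymmetric
polynomial which has coefficient one at `stairs M v`. -/
theorem coeff_smul_eq [IsDomain R] [CharZero R] (hf : BlockAntisymm M v q f) (hq : 0 < q)
    {Δ : MvPolynomial (ℕ × ℕ) R} (hΔ : BlockAntisymm M v 1 Δ) (hone : coeff (stairs M v) Δ = 1)
    (w : ℕ × ℕ →₀ ℕ) : coeff (q • w) f = coeff (q • stairs M v) f * coeff w Δ := by
  rw [← sub_eq_zero]
  have hor (u : ℕ × ℕ →₀ ℕ) (hu : coeff (q • u) f - coeff (q • stairs M v) f * coeff u Δ ≠ 0) :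
      coeff (q • u) f ≠ 0 ∨ coeff (1 • u) Δ ≠ 0 := by
    by_contra! h
    rw [one_smul] at h
    simp [h.1, h.2] at hu
  refine eq_zero_of_antisymm (M := M) (v := v)
    (K := fun w => coeff (q • w) f - coeff (q • stairs M v) f * coeff w Δ) ?_ ?_ ?_ ?_ w
  · intro u hu e he
    exact (hor u hu).elim (fun h => hf.exponent_mem h he) fun h => hΔ.exponent_mem h he
  · intro u hu e he
    exact (hor u hu).elim (fun h => hf.exponent_eq_zero hq h he)
      fun h => hΔ.exponent_eq_zero one_pos h he
  · intro m i j hi hj hij u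
    have h := hΔ.coeff_swap hi hj hij u
    rw [one_smul, one_smul] at h
    simp only [hf.coeff_swap hi hj hij u, h]
    ring
  · simp [hone]

/-- Multiplying by the ghost terms of a symmetric polynomial of small degree. -/
theorem mul_ghost {p : ℕ} (hp : 2 ≤ p) {ψ : R →+* R} {Δ Λ : MvPolynomial (ℕ × ℕ) R}
    (hΔ : BlockAntisymm M v 1 Δ)
    (hdeg : ∀ e ∈ blockIdx M v, degreeOf e Λ ≤ (p - 1) * (v e.1 + 1))
    (hzero : ∀ e ∉ blockIdx M v, degreeOf e Λ = 0)
    (hsymm : ∀ m i j, (m, i) ∈ blockIdx M v → (m, j) ∈ blockIdx M v →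
      rename (Equiv.swap (m, i) (m, j)) Λ = Λ) (s : ℕ) :
    BlockAntisymm M v (p ^ (s + 1)) (Δ * ghost p (frobMv p ψ) Λ s) where
  dvd e he := (hΔ.dvd e he).mul_right _
  degree_lt e he := by
    have h1 := hΔ.degree_lt e he
    have h2 := degreeOf_ghost_le (p := p) (ψ := ψ) (hdeg e he) s
    rw [← mul_assoc, Nat.geomSum_eq hp, Nat.div_mul_cancel
      (Nat.sub_one_dvd_pow_sub_one p (s + 1))] at h2
    refine (degreeOf_mul_le _ _ _).trans_lt ((add_lt_add_of_lt_of_le h1 h2).trans_le ?_)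
    rw [← add_mul, Nat.add_sub_cancel' (Nat.one_le_pow _ _ (by omega))]
  degree_eq e he := by
    have h2 := degreeOf_ghost_le (p := p) (ψ := ψ) (hzero e he).le s
    have h3 := degreeOf_mul_le e Δ (ghost p (frobMv p ψ) Λ s)
    rw [hΔ.degree_eq e he] at h3
    omega
  antisymm m i j hi hj hij := by
    rw [map_mul, hΔ.antisymm m i j hi hj hij, rename_ghost (hsymm m i j hi hj), neg_mul]

end BlockAntisymm

end Rigidity

section Vandermonde

variable {R : Type*} [CommRing R]

/-- The pairs `(i, j)` with `i < j` in `[1, N]`. -/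
abbrev ltPairs (N : ℕ) : Finset (ℕ × ℕ) :=
  (Icc 1 N ×ˢ Icc 1 N).filter fun ij => ij.1 < ij.2

/-- The pairs `(i, j)` with `i ≠ j` in `[1, N]`. -/
abbrev nePairs (N : ℕ) : Finset (ℕ × ℕ) :=
  (Icc 1 N ×ˢ Icc 1 N).filter fun ij => ij.1 ≠ ij.2

lemma prod_Icc_one_eq_prod_fin {A : Type*} [CommMonoid A] (N : ℕ) (f : ℕ → A) :
    ∏ a ∈ Icc 1 N, f a = ∏ t : Fin N, f (t + 1) := by
  rw [← Finset.prod_range (fun t => f (t + 1)), Finset.range_eq_Ico, Finset.prod_Ico_add' f]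
  rfl

lemma prod_ltPairs_eq_prod_fin {A : Type*} [CommMonoid A] (N : ℕ) (f : ℕ → ℕ → A) :
    ∏ ij ∈ ltPairs N, f ij.1 ij.2 = ∏ t : Fin N, ∏ u > t, f (t + 1) (u + 1) := by
  rw [prod_filter, prod_product, prod_Icc_one_eq_prod_fin]
  refine prod_congr rfl fun t _ => ?_
  rw [prod_Icc_one_eq_prod_fin]
  simp only [add_lt_add_iff_right, Fin.val_fin_lt]
  rw [← prod_filter]
  congr 1
  ext u
  simp

lemma prod_ltPairs_swap (N : ℕ) (f : ℕ → R) {i j : ℕ} (hi : i ∈ Icc 1 N) (hj : j ∈ Icc 1 N)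
    (hij : i ≠ j) :
    ∏ ab ∈ ltPairs N, (f (Equiv.swap i j ab.2) - f (Equiv.swap i j ab.1)) =
      -∏ ab ∈ ltPairs N, (f ab.2 - f ab.1) := by
  rw [mem_Icc] at hi hj
  obtain ⟨i, rfl⟩ := Nat.exists_eq_add_of_le' hi.1
  obtain ⟨j, rfl⟩ := Nat.exists_eq_add_of_le' hj.1
  rw [prod_ltPairs_eq_prod_fin N fun a b => f (Equiv.swap (i + 1) (j + 1) b) -
      f (Equiv.swap (i + 1) (j + 1) a), prod_ltPairs_eq_prod_fin N fun a b => f b - f a]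
  have hval (t : Fin N) : Equiv.swap (i + 1) (j + 1) (t + 1 : ℕ) =
      (Equiv.swap (⟨i, by omega⟩ : Fin N) ⟨j, by omega⟩ t : ℕ) + 1 := by
    simp only [Equiv.swap_apply_def, Nat.add_right_cancel_iff, Fin.ext_iff]
    split_ifs <;> rfl
  simp only [hval]
  have := Equiv.Perm.prod_Ioi_comp_eq_sign_mul_prod
    (Equiv.swap (⟨i, by omega⟩ : Fin N) ⟨j, by omega⟩)
    (f := fun t u => f (u + 1) - f (t + 1)) (by simp)
  rw [this, Equiv.Perm.sign_swap (by simpa [Fin.ext_iff] using hij)]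
  simp

/-- The product of the Vandermonde polynomials of the blocks. -/
noncomputable def vandProd (R : Type*) [CommRing R] (M : Finset ℕ) (v : ℕ → ℕ) :
    MvPolynomial (ℕ × ℕ) R :=
  ∏ m ∈ M, ∏ ij ∈ ltPairs (v m), (X (m, ij.2) - X (m, ij.1))

/-- The product of all variables times the Vandermonde polynomials of the blocks. -/
noncomputable def altPoly (R : Type*) [CommRing R] (M : Finset ℕ) (v : ℕ → ℕ) :
    MvPolynomial (ℕ × ℕ) R :=
  (∏ e ∈ blockIdx M v, X e) * vandProd R M v

lemma map_altPoly {S : Type*} [CommRing S] (f : R →+* S) (M : Finset ℕ) (v : ℕ → ℕ) :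
    MvPolynomial.map f (altPoly R M v) = altPoly S M v := by
  simp [altPoly, vandProd, map_prod]

lemma rename_swap_altPoly {M : Finset ℕ} {v : ℕ → ℕ} {m i j : ℕ}
    (hi : (m, i) ∈ blockIdx M v) (hj : (m, j) ∈ blockIdx M v) (hij : i ≠ j) :
    rename (Equiv.swap (m, i) (m, j)) (altPoly R M v) = -altPoly R M v := by
  have h1 : rename (Equiv.swap (m, i) (m, j)) (∏ e ∈ blockIdx M v, X (R := R) e) =
      ∏ e ∈ blockIdx M v, X (R := R) e := by
    simp only [map_prod, rename_X]
    refine Equiv.Perm.prod_comp _ _ (fun e => X (R := R) e) fun e he => ?_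
    rw [Set.mem_ofPred_eq, Equiv.swap_apply_ne_self_iff] at he
    obtain ⟨-, rfl | rfl⟩ := he <;> assumption
  have hblock (m' : ℕ) (hm' : m' ≠ m) :
      ∏ ab ∈ ltPairs (v m'), (X (R := R) (Equiv.swap (m, i) (m, j) (m', ab.2)) -
        X (Equiv.swap (m, i) (m, j) (m', ab.1))) =
      ∏ ab ∈ ltPairs (v m'), (X (m', ab.2) - X (m', ab.1)) := by
    refine prod_congr rfl fun ab _ => ?_
    rw [Equiv.swap_apply_of_ne_of_ne, Equiv.swap_apply_of_ne_of_ne] <;> simp [hm']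
  have hsw (t : ℕ) : Equiv.swap (m, i) (m, j) (m, t) = (m, Equiv.swap i j t) := by
    simp only [Equiv.swap_apply_def, Prod.mk.injEq, true_and]
    split_ifs <;> rfl
  rw [mem_blockIdx] at hi hj
  rw [altPoly, map_mul, h1, vandProd, map_prod, ← mul_neg]
  congr 1
  simp only [map_prod, map_sub, rename_X]
  rw [← mul_prod_erase M _ hi.1, ← mul_prod_erase M _ hi.1, ← neg_mul]
  congr 1
  · simp only [hsw]
    exact prod_ltPairs_swap (v m) (fun t => X (R := R) (m, t)) (mem_Icc.mpr hi.2)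
      (mem_Icc.mpr hj.2) hij
  · exact prod_congr rfl fun m' hm' => hblock m' (ne_of_mem_erase hm')

section Counting

lemma sum_block_indicator {ι : Type*} (M : Finset ℕ) (g : ℕ → Finset ι) (π : ι → ℕ) (x y : ℕ) :
    ∑ m ∈ M, ∑ a ∈ g m, (if (x, y) = (m, π a) then 1 else 0) =
      if x ∈ M then ∑ a ∈ g x, (if y = π a then 1 else 0) else 0 := by
  split_ifs with hx
  · rw [sum_eq_single_of_mem x hx fun m _ hm => by simp [hm.symm]]
    simp
  · refine sum_eq_zero fun m hm => sum_eq_zero fun a _ => if_neg ?_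
    rintro h
    rw [(Prod.mk.inj h).1] at hx
    exact hx hm

lemma sum_ltPairs_snd (N y : ℕ) :
    ∑ ij ∈ ltPairs N, (if y = ij.2 then 1 else 0) = if y ∈ Icc 1 N then y - 1 else 0 := by
  rw [sum_filter, sum_product_right]
  simp only [← ite_and]
  simp only [and_comm (b := y = _), ite_and, sum_ite_irrel, sum_const_zero, sum_ite_eq]
  refine ite_congr rfl (fun h => ?_) fun _ => rfl
  rw [← sum_filter, sum_const, smul_eq_mul, mul_one,
    show (Icc 1 N).filter (· < y) = Ico 1 y by ext; rw [mem_Icc] at h; simp; omega, Nat.card_Ico]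

lemma sum_ltPairs_fst (N y : ℕ) :
    ∑ ij ∈ ltPairs N, (if y = ij.1 then 1 else 0) = if y ∈ Icc 1 N then N - y else 0 := by
  rw [sum_filter, sum_product]
  simp only [← ite_and]
  simp only [and_comm (b := y = _), ite_and, sum_ite_irrel, sum_const_zero, sum_ite_eq]
  refine ite_congr rfl (fun h => ?_) fun _ => rfl
  rw [← sum_filter, sum_const, smul_eq_mul, mul_one,
    show (Icc 1 N).filter (y < ·) = Ioc y N by ext; rw [mem_Icc] at h; simp; omega, Nat.card_Ioc]

lemma sum_nePairs_snd (N y : ℕ) :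
    ∑ ij ∈ nePairs N, (if y = ij.2 then 1 else 0) = if y ∈ Icc 1 N then N - 1 else 0 := by
  rw [sum_filter, sum_product_right]
  simp only [← ite_and]
  simp only [and_comm (b := y = _), ite_and, sum_ite_irrel, sum_const_zero, sum_ite_eq]
  refine ite_congr rfl (fun h => ?_) fun _ => rfl
  rw [← sum_filter, sum_const, smul_eq_mul, mul_one, filter_ne',
    card_erase_of_mem h, Nat.card_Icc, Nat.add_sub_cancel]

lemma sum_nePairs_fst (N y : ℕ) :
    ∑ ij ∈ nePairs N, (if y = ij.1 then 1 else 0) = if y ∈ Icc 1 N then N - 1 else 0 := by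
  rw [sum_filter, sum_product]
  simp only [← ite_and]
  simp only [and_comm (b := y = _), ite_and, sum_ite_irrel, sum_const_zero, sum_ite_eq]
  refine ite_congr rfl (fun h => ?_) fun _ => rfl
  rw [← sum_filter, sum_const, smul_eq_mul, mul_one, filter_ne,
    card_erase_of_mem h, Nat.card_Icc, Nat.add_sub_cancel]

end Counting

section LeadingTerm

/-- The polynomial `f` is the sum of the monomial with exponent `e` and terms of smaller weight,
where the variable with index `(m, j)` has weight `j`. -/
def HasLeadingExponent (f : MvPolynomial (ℕ × ℕ) R) (e : ℕ × ℕ →₀ ℕ) : Prop :=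
  coeff e f = 1 ∧ ∀ u, coeff u f ≠ 0 →
    u = e ∨ Finsupp.weight (Prod.snd : ℕ × ℕ → ℕ) u < Finsupp.weight Prod.snd e

lemma HasLeadingExponent.mul {f g : MvPolynomial (ℕ × ℕ) R} {e e' : ℕ × ℕ →₀ ℕ}
    (hf : HasLeadingExponent f e) (hg : HasLeadingExponent g e') :
    HasLeadingExponent (f * g) (e + e') := by
  constructor
  · rw [coeff_mul, sum_eq_single (e, e'), hf.1, hg.1, one_mul]
    · rintro ⟨a, b⟩ hab hne
      rw [HasAntidiagonal.mem_antidiagonal] at hab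
      by_contra h
      have hw := congrArg (Finsupp.weight (Prod.snd : ℕ × ℕ → ℕ)) hab
      simp only [map_add] at hw
      rcases hf.2 a (left_ne_zero_of_mul h) with rfl | ha <;>
        rcases hg.2 b (right_ne_zero_of_mul h) with rfl | hb
      · exact hne rfl
      all_goals omega
    · intro h
      simp at h
  · intro u hu
    rw [coeff_mul] at hu
    obtain ⟨⟨a, b⟩, hab, h⟩ := exists_ne_zero_of_sum_ne_zero hu
    rw [HasAntidiagonal.mem_antidiagonal] at hab
    subst hab
    simp only [map_add]
    rcases hf.2 a (left_ne_zero_of_mul h) with rfl | ha <;>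
      rcases hg.2 b (right_ne_zero_of_mul h) with rfl | hb
    · exact Or.inl rfl
    all_goals right; omega

lemma HasLeadingExponent.prod {ι : Type*} {S : Finset ι} {f : ι → MvPolynomial (ℕ × ℕ) R}
    {e : ι → ℕ × ℕ →₀ ℕ} (h : ∀ i ∈ S, HasLeadingExponent (f i) (e i)) :
    HasLeadingExponent (∏ i ∈ S, f i) (∑ i ∈ S, e i) := by
  classical
  induction S using Finset.induction_on with
  | empty =>
    refine ⟨by simp, fun u hu => Or.inl ?_⟩
    rw [prod_empty, coeff_one] at hu
    split_ifs at hu with h0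
    · exact h0.symm
    · exact absurd rfl hu
  | insert i S hi ih =>
    rw [prod_insert hi, sum_insert hi]
    exact (h i (mem_insert_self _ _)).mul (ih fun j hj => h j (mem_insert_of_mem hj))

lemma hasLeadingExponent_X (e : ℕ × ℕ) :
    HasLeadingExponent (X e : MvPolynomial (ℕ × ℕ) R) (Finsupp.single e 1) := by
  classical
  refine ⟨by simp, fun u hu => Or.inl ?_⟩
  by_contra hne
  rw [coeff_X, if_neg (Ne.symm hne)] at hu
  exact hu rfl

lemma hasLeadingExponent_X_sub_X {e e' : ℕ × ℕ} (h : e'.2 < e.2) :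
    HasLeadingExponent (X e - X e' : MvPolynomial (ℕ × ℕ) R) (Finsupp.single e 1) := by
  classical
  have hne : e' ≠ e := by rintro rfl; exact lt_irrefl _ h
  refine ⟨by simp [coeff_X, Finsupp.single_left_inj, hne], fun u hu => ?_⟩
  rw [coeff_sub, coeff_X, coeff_X] at hu
  split_ifs at hu with h1 h2 h2
  · exact Or.inl h1.symm
  · exact Or.inl h1.symm
  · right
    rw [← h2]
    simpa [Finsupp.weight_apply] using h
  · simp at hu

lemma sum_blockIdx {A : Type*} [AddCommMonoid A] (M : Finset ℕ) (v : ℕ → ℕ) (f : ℕ × ℕ → A) :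
    ∑ e ∈ blockIdx M v, f e = ∑ m ∈ M, ∑ j ∈ Icc 1 (v m), f (m, j) := by
  simp [blockIdx, Finset.sum_map, Finset.sum_sigma]

lemma coeff_stairs_altPoly (M : Finset ℕ) (v : ℕ → ℕ) :
    coeff (stairs M v) (altPoly R M v) = 1 := by
  have h := (HasLeadingExponent.prod (R := R) fun e (_ : e ∈ blockIdx M v) =>
    hasLeadingExponent_X e).mul
      (HasLeadingExponent.prod fun m (_ : m ∈ M) => HasLeadingExponent.prod
        fun ij (hij : ij ∈ ltPairs (v m)) => hasLeadingExponent_X_sub_X (R := R)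
          (e := (m, ij.2)) (e' := (m, ij.1)) (mem_filter.mp hij).2)
  have hJ : stairs M v = ∑ e ∈ blockIdx M v, Finsupp.single e 1 +
      ∑ m ∈ M, ∑ ij ∈ ltPairs (v m), Finsupp.single (m, ij.2) 1 := by
    ext ⟨x, y⟩
    have h1 : ∑ e ∈ blockIdx M v, (Finsupp.single e 1 : ℕ × ℕ →₀ ℕ) (x, y) =
        if (x, y) ∈ blockIdx M v then 1 else 0 := by
      simp [Finsupp.single_apply]
    have h2 : ∑ m ∈ M, ∑ ij ∈ ltPairs (v m), (Finsupp.single (m, ij.2) 1 : ℕ × ℕ →₀ ℕ) (x, y) =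
        if (x, y) ∈ blockIdx M v then y - 1 else 0 := by
      simp only [Finsupp.single_apply, eq_comm (b := (x, y))]
      rw [sum_block_indicator, sum_ltPairs_snd]
      simp only [mem_blockIdx, mem_Icc, ite_and]
    rw [stairs_apply, Finsupp.add_apply, Finsupp.finsetSum_apply, Finsupp.finsetSum_apply]
    simp only [Finsupp.finsetSum_apply]
    rw [h1, h2]
    split_ifs with hI
    · have := (mem_blockIdx.mp hI).2.1
      dsimp only at this ⊢
      omega
    · rfl
  rw [hJ]
  exact h.1

end LeadingTerm

end Vandermonde

section Degrees

variable {R : Type*} [CommRing R] [Nontrivial R]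

lemma degreeOf_X_sub_X_le (e a b : ℕ × ℕ) : degreeOf e (X a - X b : MvPolynomial (ℕ × ℕ) R) ≤
    (if e = a then 1 else 0) + (if e = b then 1 else 0) := by
  refine (degreeOf_sub_le _ _ _).trans ?_
  rw [degreeOf_X, degreeOf_X]
  omega

lemma degreeOf_prod_X_le (M : Finset ℕ) (v : ℕ → ℕ) (e : ℕ × ℕ) :
    degreeOf e (∏ a ∈ blockIdx M v, X (R := R) a) ≤ if e ∈ blockIdx M v then 1 else 0 := by
  refine (degreeOf_prod_le _ _ _).trans ?_
  simp [degreeOf_X]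

lemma degreeOf_altPoly_le (M : Finset ℕ) (v : ℕ → ℕ) (e : ℕ × ℕ) :
    degreeOf e (altPoly R M v) ≤ if e ∈ blockIdx M v then v e.1 else 0 := by
  obtain ⟨x, y⟩ := e
  have h : degreeOf (x, y) (vandProd R M v) ≤
      ∑ m ∈ M, ∑ ij ∈ ltPairs (v m), (if (x, y) = (m, ij.2) then 1 else 0) +
      ∑ m ∈ M, ∑ ij ∈ ltPairs (v m), (if (x, y) = (m, ij.1) then 1 else 0) := by
    rw [← sum_add_distrib]
    refine (degreeOf_prod_le _ _ _).trans (sum_le_sum fun m _ => ?_)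
    rw [← sum_add_distrib]
    exact (degreeOf_prod_le _ _ _).trans (sum_le_sum fun ij _ => degreeOf_X_sub_X_le _ _ _)
  rw [sum_block_indicator, sum_block_indicator, sum_ltPairs_snd, sum_ltPairs_fst] at h
  refine (degreeOf_mul_le _ _ _).trans
    ((add_le_add (degreeOf_prod_X_le M v (x, y)) h).trans ?_)
  simp only [mem_blockIdx, mem_Icc]
  by_cases h1 : x ∈ M <;> by_cases h2 : 1 ≤ y ∧ y ≤ v x <;> simp only [h1, h2, and_self, if_true,
    if_false, and_false, false_and, le_refl, add_zero]
  omega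

lemma blockAntisymm_altPoly (M : Finset ℕ) (v : ℕ → ℕ) :
    BlockAntisymm M v 1 (altPoly R M v) where
  dvd e he := (dvd_prod_of_mem _ he).mul_right _
  degree_lt e he := by
    have := degreeOf_altPoly_le (R := R) M v e
    rw [if_pos he] at this
    omega
  degree_eq e he := by
    have := degreeOf_altPoly_le (R := R) M v e
    rw [if_neg he] at this
    omega
  antisymm m i j hi hj hij := rename_swap_altPoly hi hj hij

end Degrees

section MasterPolynomial

variable {R : Type*} [CommRing R]

/-- The symmetric factor of the superpotential at `q = 1`, with arbitrary exponents. -/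
noncomputable def masterPoly (z : R) (k n a b c : ℕ) : MvPolynomial (ℕ × ℕ) R :=
  (∏ m ∈ Icc 1 (n - 1), ∏ j ∈ Icc 1 (dimv k n m), X (m, j)) ^ a *
  (∏ m ∈ Icc 1 (n - 1), ∏ ij ∈ nePairs (dimv k n m), (X (m, ij.1) - X (m, ij.2))) ^ b *
  (∏ i ∈ Icc 1 (n - 2), ∏ x ∈ Icc 1 (dimv k n i), ∏ y ∈ Icc 1 (dimv k n (i + 1)),
    (X (i, x) - X (i + 1, y))) ^ c *
  (∏ i ∈ Icc 1 k, (C z - X (k, i)) * (1 - X (n - k, i))) ^ c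

lemma masterPoly_pow (z : R) (k n a b c N : ℕ) :
    masterPoly z k n (a * N) (b * N) (c * N) = masterPoly z k n a b c ^ N := by
  simp only [masterPoly, pow_mul, mul_pow]

lemma rename_masterPoly (z : R) {k n : ℕ} (a b c : ℕ) (hn : 2 * k ≤ n)
    {π : ℕ → Equiv.Perm ℕ} (hπ : ∀ m, {t | π m t ≠ t} ⊆ ↑(Icc 1 (dimv k n m))) :
    rename (fun e : ℕ × ℕ => (e.1, π e.1 e.2)) (masterPoly z k n a b c) =
      masterPoly z k n a b c := by
  have hcomp (m : ℕ) (f : ℕ → MvPolynomial (ℕ × ℕ) R) :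
      ∏ t ∈ Icc 1 (dimv k n m), f (π m t) = ∏ t ∈ Icc 1 (dimv k n m), f t :=
    Equiv.Perm.prod_comp (π m) _ f (hπ m)
  simp only [masterPoly, map_mul, map_pow]
  congr 1
  · congr 1
    · congr 1
      · simp only [map_prod, rename_X]
        exact congrArg (· ^ a) (prod_congr rfl fun m _ => hcomp m fun t => X (m, t))
      · simp only [map_prod, map_sub, rename_X]
        refine congrArg (· ^ b) (prod_congr rfl fun m _ => ?_)
        rw [prod_filter, prod_filter, prod_product, prod_product]
        have h2 (i : ℕ) : (∏ j ∈ Icc 1 (dimv k n m), if i ≠ j then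
            (X (m, π m i) - X (m, π m j) : MvPolynomial (ℕ × ℕ) R) else 1) =
            ∏ j ∈ Icc 1 (dimv k n m), if π m i ≠ j then X (m, π m i) - X (m, j) else 1 := by
          rw [← hcomp m fun j => if π m i ≠ j then X (m, π m i) - X (m, j) else 1]
          simp only [ne_eq, EmbeddingLike.apply_eq_iff_eq]
        simp only [h2]
        exact hcomp m fun i => ∏ j ∈ Icc 1 (dimv k n m),
          if i ≠ j then X (m, i) - X (m, j) else 1
    · simp only [map_prod, map_sub, rename_X]
      refine congrArg (· ^ c) (prod_congr rfl fun m _ => ?_)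
      rw [hcomp m fun x => ∏ y ∈ Icc 1 (dimv k n (m + 1)), (X (m, x) - X (m + 1, π (m + 1) y))]
      exact prod_congr rfl fun x _ => hcomp (m + 1) fun y => X (m, x) - X (m + 1, y)
  · have e1 : dimv k n k = k := by simp only [dimv]; omega
    have e2 : dimv k n (n - k) = k := by simp only [dimv]; omega
    have h1 := hcomp k fun t => C z - X (k, t)
    have h2 := hcomp (n - k) fun t => 1 - X (n - k, t)
    rw [e1] at h1
    rw [e2] at h2
    simp only [map_prod, map_sub, map_mul, rename_X, map_one, rename_C, prod_mul_distrib, h1, h2]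

lemma rename_swap_masterPoly (z : R) {k n : ℕ} (a b c : ℕ) (hn : 2 * k ≤ n) {m i j : ℕ}
    (hi : (m, i) ∈ blockIdx (Icc 1 (n - 1)) (dimv k n))
    (hj : (m, j) ∈ blockIdx (Icc 1 (n - 1)) (dimv k n)) :
    rename (Equiv.swap (m, i) (m, j)) (masterPoly z k n a b c) = masterPoly z k n a b c := by
  rw [mem_blockIdx] at hi hj
  have h : (Equiv.swap (m, i) (m, j) : ℕ × ℕ → ℕ × ℕ) =
      fun e => (e.1, (if e.1 = m then Equiv.swap i j else 1 : Equiv.Perm ℕ) e.2) := by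
    funext ⟨x, y⟩
    by_cases hx : x = m
    · subst hx
      simp only [Equiv.swap_apply_def, Prod.mk.injEq, true_and, if_true]
      split_ifs <;> rfl
    · rw [Equiv.swap_apply_of_ne_of_ne] <;> simp [hx]
  rw [h]
  refine rename_masterPoly z a b c hn (π := fun x => if x = m then Equiv.swap i j else 1)
    fun x t ht => ?_
  rw [Set.mem_ofPred_eq] at ht
  split_ifs at ht with hx
  · subst hx
    rw [Equiv.swap_apply_ne_self_iff] at ht
    rw [coe_Icc]
    obtain ⟨-, rfl | rfl⟩ := ht
    · exact hi.2
    · exact hj.2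
  · simp at ht

lemma sum_edges_fst (S : Finset ℕ) (v : ℕ → ℕ) (x y : ℕ) :
    ∑ i ∈ S, ∑ a ∈ Icc 1 (v i), ∑ _b ∈ Icc 1 (v (i + 1)), (if (x, y) = (i, a) then 1 else 0) =
      if x ∈ S ∧ y ∈ Icc 1 (v x) then v (x + 1) else 0 := by
  simp [ite_and, -mem_Icc]

lemma sum_edges_snd (S : Finset ℕ) (v : ℕ → ℕ) (x y : ℕ) :
    ∑ i ∈ S, ∑ _a ∈ Icc 1 (v i), ∑ b ∈ Icc 1 (v (i + 1)),
      (if (x + 1, y) = (i + 1, b) then 1 else 0) =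
      if x ∈ S ∧ y ∈ Icc 1 (v (x + 1)) then v x else 0 := by
  simp [ite_and, -mem_Icc]

lemma degreeOf_masterPoly_le [Nontrivial R] (z : R) {k n a b c P : ℕ} (hk : 1 ≤ k)
    (hn : 2 * k ≤ n) (ha : a + c = P) (hb : 2 * b + 2 * c = P) (e : ℕ × ℕ) :
    degreeOf e (masterPoly z k n a b c) ≤
      if e ∈ blockIdx (Icc 1 (n - 1)) (dimv k n) then P * (dimv k n e.1 + 1) else 0 := by
  obtain ⟨x, y⟩ := e
  have h1 : degreeOf (x, y) ((∏ m ∈ Icc 1 (n - 1), ∏ j ∈ Icc 1 (dimv k n m),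
      (X (m, j) : MvPolynomial (ℕ × ℕ) R)) ^ a) ≤
      a * if (x, y) ∈ blockIdx (Icc 1 (n - 1)) (dimv k n) then 1 else 0 := by
    rw [← prod_blockIdx]
    exact (degreeOf_pow_le _ _ _).trans (Nat.mul_le_mul_left _ (degreeOf_prod_X_le _ _ _))
  have h2 : degreeOf (x, y) ((∏ m ∈ Icc 1 (n - 1), ∏ ij ∈ nePairs (dimv k n m),
      (X (m, ij.1) - X (m, ij.2) : MvPolynomial (ℕ × ℕ) R)) ^ b) ≤
      b * (∑ m ∈ Icc 1 (n - 1), ∑ ij ∈ nePairs (dimv k n m),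
          (if (x, y) = (m, ij.1) then 1 else 0) +
        ∑ m ∈ Icc 1 (n - 1), ∑ ij ∈ nePairs (dimv k n m),
          (if (x, y) = (m, ij.2) then 1 else 0)) := by
    refine (degreeOf_pow_le _ _ _).trans (Nat.mul_le_mul_left _ ?_)
    rw [← sum_add_distrib]
    refine (degreeOf_prod_le _ _ _).trans (sum_le_sum fun m _ => ?_)
    rw [← sum_add_distrib]
    exact (degreeOf_prod_le _ _ _).trans (sum_le_sum fun ij _ => degreeOf_X_sub_X_le _ _ _)
  rw [sum_block_indicator, sum_block_indicator, sum_nePairs_snd, sum_nePairs_fst] at h2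
  have h3 : degreeOf (x, y) ((∏ i ∈ Icc 1 (n - 2), ∏ s ∈ Icc 1 (dimv k n i),
      ∏ t ∈ Icc 1 (dimv k n (i + 1)), (X (i, s) - X (i + 1, t) : MvPolynomial (ℕ × ℕ) R)) ^ c) ≤
      c * (∑ i ∈ Icc 1 (n - 2), ∑ s ∈ Icc 1 (dimv k n i), ∑ t ∈ Icc 1 (dimv k n (i + 1)),
          (if (x, y) = (i, s) then 1 else 0) +
        ∑ i ∈ Icc 1 (n - 2), ∑ s ∈ Icc 1 (dimv k n i), ∑ t ∈ Icc 1 (dimv k n (i + 1)),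
          (if (x, y) = (i + 1, t) then 1 else 0)) := by
    refine (degreeOf_pow_le _ _ _).trans (Nat.mul_le_mul_left _ ?_)
    rw [← sum_add_distrib]
    refine (degreeOf_prod_le _ _ _).trans (sum_le_sum fun m _ => ?_)
    rw [← sum_add_distrib]
    refine (degreeOf_prod_le _ _ _).trans (sum_le_sum fun m _ => ?_)
    rw [← sum_add_distrib]
    exact (degreeOf_prod_le _ _ _).trans (sum_le_sum fun ij _ => degreeOf_X_sub_X_le _ _ _)
  rw [sum_edges_fst] at h3
  have h4 : degreeOf (x, y) ((∏ i ∈ Icc 1 k, (C z - X (k, i)) *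
      (1 - X (n - k, i) : MvPolynomial (ℕ × ℕ) R)) ^ c) ≤
      c * ((if x = k ∧ y ∈ Icc 1 k then 1 else 0) +
        if x = n - k ∧ y ∈ Icc 1 k then 1 else 0) := by
    refine (degreeOf_pow_le _ _ _).trans (Nat.mul_le_mul_left _ ?_)
    have h5 : ∑ i ∈ Icc 1 k, ((if (x, y) = (k, i) then 1 else 0) +
        (if (x, y) = (n - k, i) then 1 else 0)) = (if x = k ∧ y ∈ Icc 1 k then 1 else 0) +
        if x = n - k ∧ y ∈ Icc 1 k then 1 else 0 := by
      rw [sum_add_distrib]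
      simp [ite_and, -mem_Icc]
    rw [← h5]
    refine (degreeOf_prod_le _ _ _).trans (sum_le_sum fun i _ => ?_)
    refine (degreeOf_mul_le _ _ _).trans (add_le_add ?_ ?_)
    · refine (degreeOf_sub_le _ _ _).trans ?_
      rw [degreeOf_X, degreeOf_C]
      simp
    · refine (degreeOf_sub_le _ _ _).trans ?_
      rw [degreeOf_X, degreeOf_one]
      simp
  refine (degreeOf_mul_le _ _ _).trans ((add_le_add ((degreeOf_mul_le _ _ _).trans (add_le_add
    ((degreeOf_mul_le _ _ _).trans (add_le_add h1 h2)) h3)) h4).trans ?_)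
  clear h1 h2 h3 h4
  have e1 : dimv k n k = k := by simp only [dimv]; omega
  have e2 : dimv k n (n - k) = k := by simp only [dimv]; omega
  obtain _ | x := x
  · have h0 : (0, y) ∉ blockIdx (Icc 1 (n - 1)) (dimv k n) := by simp [mem_blockIdx]
    rw [if_neg h0, if_neg h0]
    simp [show 0 ≠ k by omega, show 0 ≠ n - k by omega]
  rw [sum_edges_snd]
  by_cases hI : (x + 1, y) ∈ blockIdx (Icc 1 (n - 1)) (dimv k n)
  · rw [if_pos hI, if_pos hI]
    rw [mem_blockIdx, mem_Icc] at hI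
    dsimp only at hI
    have hsum : (if x + 1 ∈ Icc 1 (n - 2) ∧ y ∈ Icc 1 (dimv k n (x + 1)) then
        dimv k n (x + 1 + 1) else 0) +
        (if x ∈ Icc 1 (n - 2) ∧ y ∈ Icc 1 (dimv k n (x + 1)) then dimv k n x else 0) +
        ((if x + 1 = k ∧ y ∈ Icc 1 k then 1 else 0) +
          if x + 1 = n - k ∧ y ∈ Icc 1 k then 1 else 0) ≤ 2 * dimv k n (x + 1) := by
      refine (add_le_add (b := dimv k n (x + 2) + dimv k n x)
        (d := (if x + 1 = k then 1 else 0) + if x + 1 = n - k then 1 else 0) ?_ ?_).trans ?_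
      · refine add_le_add ?_ ?_ <;> split_ifs <;> first | exact le_rfl | exact Nat.zero_le _
      · refine add_le_add ?_ ?_ <;> split_ifs <;> first | exact le_rfl | simp_all
      · simp only [dimv]
        split_ifs <;> omega
    have hpos : (if x + 1 ∈ Icc 1 (n - 1) then
        (if y ∈ Icc 1 (dimv k n (x + 1)) then dimv k n (x + 1) - 1 else 0) else 0) =
        dimv k n (x + 1) - 1 := by
      rw [if_pos (mem_Icc.mpr hI.1), if_pos (mem_Icc.mpr hI.2)]
    rw [hpos]
    have hmul := Nat.mul_le_mul_left c hsum
    rw [mul_add] at hmul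
    obtain ⟨t, ht⟩ : ∃ t, dimv k n (x + 1) = t + 1 := ⟨dimv k n (x + 1) - 1, by omega⟩
    rw [ht] at hmul ⊢
    rw [Nat.add_sub_cancel]
    rw [show a * 1 + b * (t + t) = a + 2 * b * t by ring]
    have : a + 2 * b * t + c * (2 * (t + 1)) ≤ P * (t + 1 + 1) := by
      have : a + 2 * b * t + c * (2 * (t + 1)) = (a + c) + (2 * b + 2 * c) * t + c := by ring
      rw [this, ha, hb]
      nlinarith
    linarith
  · rw [if_neg hI, if_neg hI]
    have hI' : ¬ (x + 1 ∈ Icc 1 (n - 1) ∧ y ∈ Icc 1 (dimv k n (x + 1))) := fun h =>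
      hI (mem_blockIdx.mpr ⟨h.1, mem_Icc.mp h.2⟩)
    have g1 : ¬ (x + 1 ∈ Icc 1 (n - 2) ∧ y ∈ Icc 1 (dimv k n (x + 1))) := fun h =>
      hI' ⟨by have := mem_Icc.mp h.1; rw [mem_Icc]; omega, h.2⟩
    have g2 : ¬ (x ∈ Icc 1 (n - 2) ∧ y ∈ Icc 1 (dimv k n (x + 1))) := fun h =>
      hI' ⟨by have := mem_Icc.mp h.1; rw [mem_Icc]; omega, h.2⟩
    have g3 : ¬ (x + 1 = k ∧ y ∈ Icc 1 k) := fun h =>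
      hI' ⟨by rw [mem_Icc]; omega, by rw [h.1, e1]; exact h.2⟩
    have g4 : ¬ (x + 1 = n - k ∧ y ∈ Icc 1 k) := fun h =>
      hI' ⟨by rw [mem_Icc]; omega, by rw [h.1, e2]; exact h.2⟩
    rw [← ite_and, if_neg hI', if_neg g1, if_neg g2, if_neg g3, if_neg g4]
    simp

end MasterPolynomial

section Exponents

variable {p r₀ q₀ : ℕ}

lemma pow_sub_one_eq_mul_geomSum (hp : 2 ≤ p) (s : ℕ) :
    p ^ s - 1 = (p - 1) * ∑ i ∈ range s, p ^ i := by
  rw [Nat.geomSum_eq hp, Nat.mul_div_cancel' (Nat.sub_one_dvd_pow_sub_one p s)]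

lemma cExp_eq_mul (hp : 2 ≤ p) (h : q₀ ∣ p - 1) (s : ℕ) :
    cExp p r₀ q₀ s = cExp p r₀ q₀ 1 * ∑ i ∈ range s, p ^ i := by
  obtain ⟨d, hd⟩ := h
  have hq : 0 < q₀ := Nat.pos_of_ne_zero (by rintro rfl; omega)
  rw [cExp, cExp, pow_one, pow_sub_one_eq_mul_geomSum hp, hd, mul_assoc, mul_assoc, mul_assoc,
    Nat.mul_div_cancel_left _ hq, Nat.mul_div_cancel_left _ hq]
  ring

lemma two_mul_cExp_one_le (hω : 2 * r₀ ≤ q₀) : 2 * cExp p r₀ q₀ 1 ≤ p - 1 := by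
  rw [cExp, pow_one]
  refine (Nat.mul_div_le_mul_div_assoc _ _ _).trans ?_
  refine Nat.div_le_of_le_mul ?_
  nlinarith [Nat.mul_le_mul_left (p - 1) hω]

lemma aExp_eq_mul (hp : 2 ≤ p) (h : q₀ ∣ p - 1) (s : ℕ) :
    aExp p r₀ q₀ s = aExp p r₀ q₀ 1 * ∑ i ∈ range s, p ^ i := by
  rw [aExp, aExp, cExp_eq_mul hp h s, pow_one, pow_sub_one_eq_mul_geomSum hp,
    Nat.sub_mul (p - 1)]

lemma two_mul_bExp_one (hodd : Odd p) (hω : 2 * r₀ ≤ q₀) :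
    2 * bExp p r₀ q₀ 1 + 2 * cExp p r₀ q₀ 1 = p - 1 := by
  have := two_mul_cExp_one_le (p := p) hω
  obtain ⟨t, rfl⟩ := hodd
  rw [bExp, pow_one]
  omega

lemma aExp_one_add_cExp_one (hω : 2 * r₀ ≤ q₀) :
    aExp p r₀ q₀ 1 + cExp p r₀ q₀ 1 = p - 1 := by
  have := two_mul_cExp_one_le (p := p) hω
  rw [aExp, pow_one]
  omega

lemma bExp_eq_mul (hp : 2 ≤ p) (hodd : Odd p) (hω : 2 * r₀ ≤ q₀) (h : q₀ ∣ p - 1) (s : ℕ) :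
    bExp p r₀ q₀ s = bExp p r₀ q₀ 1 * ∑ i ∈ range s, p ^ i := by
  have hb := two_mul_bExp_one (r₀ := r₀) hodd hω
  rw [bExp, cExp_eq_mul hp h s, pow_sub_one_eq_mul_geomSum hp, ← hb, add_mul,
    mul_assoc 2 (cExp _ _ _ _),
    Nat.add_sub_cancel, mul_assoc, Nat.mul_div_cancel_left _ two_pos]

end Exponents

section QOne

lemma evalQOne_one_Zvar : evalQOne 1 Zvar = Polynomial.X := by
  simp [evalQOne, Zvar]

lemma evalQOne_Qvar (e : ℕ) : evalQOne e Qvar = 1 := by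
  simp [evalQOne, Qvar]

lemma evalQOne_eq_expand_comp (p : ℕ) :
    evalQOne p = (Polynomial.expand ℤ p).toRingHom.comp (evalQOne 1) := by
  refine MvPolynomial.ringHom_ext (fun a => ?_) fun b => ?_
  · simp [evalQOne]
  · cases b <;> simp [evalQOne]

lemma map_evalQOne_Phibar (p r₀ q₀ k n s : ℕ) :
    MvPolynomial.map (evalQOne 1) (Phibar p r₀ q₀ k n s) =
      masterPoly (Polynomial.X : Polynomial ℤ) k n
        (aExp p r₀ q₀ s) (bExp p r₀ q₀ s) (cExp p r₀ q₀ s) := by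
  simp only [Phibar, masterPoly, map_mul, map_pow, map_prod, map_sub, map_one,
    MvPolynomial.map_X, MvPolynomial.map_C, evalQOne_one_Zvar, evalQOne_Qvar, one_pow, one_mul,
    prod_const, card_range, prod_pow]

lemma map_evalQOne_Vand (k n : ℕ) :
    MvPolynomial.map (evalQOne 1) (Vand k n) =
      vandProd (Polynomial ℤ) (Icc 1 (n - 1)) (dimv k n) := by
  simp only [Vand, vandProd, map_prod, map_sub, MvPolynomial.map_X]

lemma expVec_add {p : ℕ} (hp : 0 < p) (k n s : ℕ) :
    (∑ e ∈ blockIdx (Icc 1 (n - 1)) (dimv k n), Finsupp.single e 1) + expVec p k n s =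
      p ^ s • stairs (Icc 1 (n - 1)) (dimv k n) := by
  have hstairs : stairs (Icc 1 (n - 1)) (dimv k n) =
      ∑ e ∈ blockIdx (Icc 1 (n - 1)) (dimv k n), Finsupp.single e e.2 := by
    ext e
    rw [stairs_apply, Finsupp.finsetSum_apply]
    simp [Finsupp.single_apply]
  rw [hstairs, expVec, smul_sum, ← sum_blockIdx _ _ fun e : ℕ × ℕ =>
    Finsupp.single e (e.2 * p ^ s - 1), ← sum_add_distrib]
  refine sum_congr rfl fun e he => ?_
  have : 0 < e.2 * p ^ s := Nat.mul_pos (mem_blockIdx.mp he).2.1 (pow_pos hp s)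
  rw [← Finsupp.single_add, Finsupp.smul_single, smul_eq_mul, mul_comm (p ^ s)]
  congr 1
  omega

lemma evalQOne_Ts {p r₀ q₀ : ℕ} (hp : 2 ≤ p) (hodd : Odd p) (hω : 2 * r₀ ≤ q₀)
    (h : q₀ ∣ p - 1) (k n s : ℕ) :
    evalQOne 1 (Ts p r₀ q₀ k n s) =
      coeff (p ^ s • stairs (Icc 1 (n - 1)) (dimv k n))
        (altPoly (Polynomial ℤ) (Icc 1 (n - 1)) (dimv k n) *
          frobProd p (masterPoly (Polynomial.X : Polynomial ℤ) k n
            (aExp p r₀ q₀ 1) (bExp p r₀ q₀ 1) (cExp p r₀ q₀ 1)) s) := by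
  have hX (S : Finset (ℕ × ℕ)) : ∏ e ∈ S, (X e : MvPolynomial (ℕ × ℕ) (Polynomial ℤ)) =
      monomial (∑ e ∈ S, Finsupp.single e 1) 1 := by
    rw [monomial_sum_one]
    rfl
  rw [Ts, ← coeff_map, Phi, map_mul, map_evalQOne_Vand, map_evalQOne_Phibar, frobProd,
    ← masterPoly_pow, ← aExp_eq_mul hp h, ← bExp_eq_mul hp hodd hω h, ← cExp_eq_mul hp h,
    altPoly, mul_assoc, hX, ← expVec_add (by omega), coeff_monomial_mul, one_mul]

lemma dvd_expand_sub_pow {p : ℕ} (hp : p.Prime) (f : Polynomial ℤ) :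
    (p : Polynomial ℤ) ∣ (Polynomial.expand ℤ p).toRingHom f - f ^ p := by
  induction f using Polynomial.induction_on with
  | C a =>
    have : Fact p.Prime := ⟨hp⟩
    have ha : (p : ℤ) ∣ a - a ^ p := by
      rw [← ZMod.intCast_zmod_eq_zero_iff_dvd]
      simp
    simpa using map_dvd (Polynomial.C : ℤ →+* Polynomial ℤ) ha
  | add f g hf hg => exact dvd_add_lift hp hf hg
  | monomial m a ih =>
    rw [pow_succ, ← mul_assoc]
    exact dvd_mul_lift ih (by simp)

end QOne

/-- **Dwork congruence at `q = 1`** (the main result of Smirnov–Varchenko):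
for every `s ≥ 1`, `p^s` divides
`T_{s+1}(z,1)·T_{s-1}(z^p,1) - T_s(z,1)·T_s(z^p,1)` in `ℤ[z]`. -/
theorem dwork_congruence_q_one (p r₀ q₀ k n : ℕ) (hp : p.Prime) (hodd : Odd p)
    (hr₀ : 0 < r₀) (hq₀ : 0 < q₀) (hω : 2 * r₀ ≤ q₀) (hcong : p ≡ 1 [MOD q₀])
    (hk : 1 ≤ k) (hn : 2 * k ≤ n) (s : ℕ) (hs : 1 ≤ s) :
    ((p : Polynomial ℤ)) ^ s ∣
      evalQOne 1 (Ts p r₀ q₀ k n (s + 1)) * evalQOne p (Ts p r₀ q₀ k n (s - 1)) -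
        evalQOne 1 (Ts p r₀ q₀ k n s) * evalQOne p (Ts p r₀ q₀ k n s) := by
  have h : q₀ ∣ p - 1 := (Nat.modEq_iff_dvd' hp.one_lt.le).mp hcong.symm
  have hdeg := degreeOf_masterPoly_le (Polynomial.X : Polynomial ℤ) hk hn
    (aExp_one_add_cExp_one (p := p) hω) (two_mul_bExp_one hodd hω)
  simp only [evalQOne_eq_expand_comp p, RingHom.comp_apply]
  refine dwork_congruence_coeff hp (dvd_expand_sub_pow hp) (map_altPoly _ _ _)
    (stairs (Icc 1 (n - 1)) (dimv k n)) (fun j => ?_)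
    (fun s => evalQOne 1 (Ts p r₀ q₀ k n s)) (evalQOne_Ts hp.two_le hodd hω h k n) s hs
  refine BlockAntisymm.coeff_smul_eq ?_ (pow_pos hp.pos _) (blockAntisymm_altPoly _ _)
    (coeff_stairs_altPoly _ _)
  refine (blockAntisymm_altPoly _ _).mul_ghost hp.two_le (fun e he => ?_) (fun e he => ?_)
    (fun m i j hi hj => rename_swap_masterPoly _ _ _ _ hn hi hj) j
  · simpa only [if_pos he] using hdeg e
  · simpa only [if_neg he, Nat.le_zero] using hdeg e
end

section
/- Let s ≥ 1 and let ζ ∈ ℂ satisfy ζ^{p^s} = 1 and ζ ≠ 1. Then, evaluating q at ζ, the exact identity T_{s+1}(z,ζ)·T_{s−1}(z^p,ζ^p) = T_s(z,ζ)·T_s(z^p,ζ^p) holds in the polynomial ring ℂ[z]. -/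
open MvPolynomial Finset

/-- Evaluation `ℤ[z,q] → ℂ[z]` sending `q ↦ ζ` and `z ↦ z^e`. -/
noncomputable def evalQ (ζ : ℂ) (e : ℕ) : Zq →+* Polynomial ℂ :=
  MvPolynomial.eval₂Hom (Int.castRingHom (Polynomial ℂ))
    (fun b => bif b then Polynomial.C ζ else Polynomial.X ^ e)

/-- The set of indices `(m, j)` with `1 ≤ m ≤ N` and `1 ≤ j ≤ v m`. -/
def blockIndices (N : ℕ) (v : ℕ → ℕ) : Finset (ℕ × ℕ) :=
  (Icc 1 N).biUnion fun m => (Icc 1 (v m)).image (Prod.mk m)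

theorem mem_blockIndices {N : ℕ} {v : ℕ → ℕ} {x : ℕ × ℕ} :
    x ∈ blockIndices N v ↔ x.1 ∈ Icc 1 N ∧ x.2 ∈ Icc 1 (v x.1) := by
  obtain ⟨m, j⟩ := x
  simp only [blockIndices, mem_biUnion, mem_image, Prod.mk.injEq]
  constructor
  · rintro ⟨m', hm', j', hj', rfl, rfl⟩
    exact ⟨hm', hj'⟩
  · rintro ⟨hm, hj⟩
    exact ⟨m, hm, j, hj, rfl, rfl⟩

/-- The product of the Vandermonde products of the blocks. -/
noncomputable def blockVandermonde (R : Type*) [CommRing R] (N : ℕ) (v : ℕ → ℕ) :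
    MvPolynomial (ℕ × ℕ) R :=
  ∏ m ∈ Icc 1 N, ∏ ij ∈ ((Icc 1 (v m)) ×ˢ (Icc 1 (v m))).filter (fun ij => ij.1 < ij.2),
    (X (m, ij.2) - X (m, ij.1))

/-- The superpotential factor with free exponents `a, b, c` and free parameters `z, q`. -/
noncomputable def superpotential {R : Type*} [CommRing R] (k n a b c : ℕ) (z q : R) :
    MvPolynomial (ℕ × ℕ) R :=
  (∏ m ∈ Icc 1 (n - 1), ∏ j ∈ Icc 1 (dimv k n m), X (m, j)) ^ a *
  (∏ m ∈ Icc 1 (n - 1),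
    ∏ ij ∈ ((Icc 1 (dimv k n m)) ×ˢ (Icc 1 (dimv k n m))).filter (fun ij => ij.1 ≠ ij.2),
      ∏ r ∈ range b, (X (m, ij.1) - C (q ^ r) * X (m, ij.2))) *
  (∏ i ∈ Icc 1 (n - 2), ∏ a ∈ Icc 1 (dimv k n i), ∏ b ∈ Icc 1 (dimv k n (i + 1)),
      ∏ r ∈ range c, (X (i, a) - C (q ^ r) * X (i + 1, b))) *
  (∏ i ∈ Icc 1 k, ∏ r ∈ range c,
      (C z - C (q ^ r) * X (k, i)) * (1 - C (q ^ r) * X (n - k, i)))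

theorem map_Phi {R : Type*} [CommRing R] (φ : Zq →+* R) (p r₀ q₀ k n s : ℕ) :
    MvPolynomial.map φ (Phi p r₀ q₀ k n s) =
      blockVandermonde R (n - 1) (dimv k n) * superpotential k n (aExp p r₀ q₀ s)
        (bExp p r₀ q₀ s) (cExp p r₀ q₀ s) (φ Zvar) (φ Qvar) := by
  simp [Phi, Vand, Phibar, blockVandermonde, superpotential, map_prod]

theorem IsPrimitiveRoot.prod_range_sub_pow_mul {A : Type*} [CommRing A] [IsDomain A] {ℓ : ℕ}
    {ζ : A} (h : IsPrimitiveRoot ζ ℓ) (hℓ : 0 < ℓ) (x y : A) :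
    ∏ r ∈ range ℓ, (x - ζ ^ r * y) = x ^ ℓ - y ^ ℓ := by
  have := congrArg (Polynomial.eval x) (X_pow_sub_C_eq_prod h hℓ (α := y) rfl)
  simpa [Polynomial.eval_prod] using this.symm

theorem IsPrimitiveRoot.prod_range_add_mul {A : Type*} [CommRing A] [IsDomain A] {ℓ : ℕ}
    {ζ : A} (h : IsPrimitiveRoot ζ ℓ) (hℓ : 0 < ℓ) (c d : ℕ) (x y : A) :
    ∏ r ∈ range (c + ℓ * d), (x - ζ ^ r * y) =
      (∏ r ∈ range c, (x - ζ ^ r * y)) * (x ^ ℓ - y ^ ℓ) ^ d := by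
  rw [add_comm, prod_range_add, mul_comm]
  congr 1
  · simp [pow_add, pow_mul, h.pow_eq_one]
  · induction d with
    | zero => simp
    | succ d ih =>
      rw [mul_add, mul_one, prod_range_add, ih, pow_succ, ← h.prod_range_sub_pow_mul hℓ]
      simp [pow_add, pow_mul, h.pow_eq_one]

theorem superpotential_add_mul {R : Type*} [CommRing R] [IsDomain R] (k n : ℕ) {ℓ : ℕ} {q : R}
    (h : IsPrimitiveRoot q ℓ) (hℓ : 0 < ℓ) (z : R) (a b c a' b' c' : ℕ) :
    superpotential k n (a + ℓ * a') (b + ℓ * b') (c + ℓ * c') z q =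
      superpotential k n a b c z q *
        expand ℓ (superpotential k n a' b' c' (z ^ ℓ) 1) := by
  have hC : IsPrimitiveRoot (C q : MvPolynomial (ℕ × ℕ) R) ℓ :=
    h.map_of_injective (C_injective _ _)
  have key : ∀ (c d : ℕ) (x y : MvPolynomial (ℕ × ℕ) R),
      ∏ r ∈ range (c + ℓ * d), (x - C q ^ r * y) =
        (∏ r ∈ range c, (x - C q ^ r * y)) * (x ^ ℓ - y ^ ℓ) ^ d :=
    hC.prod_range_add_mul hℓ
  simp only [superpotential, map_mul, map_pow, map_prod, map_sub, expand_X, expand_C, map_one,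
    one_pow, one_mul, prod_const, card_range, prod_mul_distrib, key, pow_add, pow_mul,
    prod_pow]
  ring

/-- The enumeration `i ↦ i + 1` of `{1, …, d}` by `Fin d`. -/
def finEquivIcc (d : ℕ) : Fin d ≃ {j // j ∈ Icc 1 d} where
  toFun i := ⟨i + 1, by simp⟩
  invFun j := ⟨j.1 - 1, by have := mem_Icc.1 j.2; omega⟩
  left_inv i := by simp
  right_inv j := by
    have := mem_Icc.1 j.2
    ext
    simp only
    omega

/-- The permutation of `ℕ` acting on `{1, …, d}` as a given permutation of `Fin d`. -/
def permIcc {d : ℕ} (ρ : Equiv.Perm (Fin d)) : Equiv.Perm ℕ := ρ.extendDomain (finEquivIcc d)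

theorem permIcc_succ {d : ℕ} (ρ : Equiv.Perm (Fin d)) (i : Fin d) :
    permIcc ρ (i + 1) = ρ i + 1 :=
  ρ.extendDomain_apply_image (finEquivIcc d) i

theorem permIcc_of_notMem {d : ℕ} (ρ : Equiv.Perm (Fin d)) {j : ℕ} (hj : j ∉ Icc 1 d) :
    permIcc ρ j = j :=
  ρ.extendDomain_apply_not_subtype (finEquivIcc d) hj

theorem permIcc_mem {d : ℕ} (ρ : Equiv.Perm (Fin d)) {j : ℕ} :
    permIcc ρ j ∈ Icc 1 d ↔ j ∈ Icc 1 d := by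
  have aux : ∀ j, j ∈ Icc 1 d → permIcc ρ j ∈ Icc 1 d := by
    intro j hj
    obtain ⟨i, hi⟩ := (finEquivIcc d).surjective ⟨j, hj⟩
    obtain rfl : (i : ℕ) + 1 = j := congrArg Subtype.val hi
    rw [permIcc_succ, mem_Icc]
    omega
  refine ⟨fun h => ?_, aux j⟩
  by_contra hj
  rw [permIcc_of_notMem ρ hj] at h
  exact hj h

theorem prod_permIcc {M : Type*} [CommMonoid M] {d : ℕ} (ρ : Equiv.Perm (Fin d)) (f : ℕ → M) :
    ∏ j ∈ Icc 1 d, f (permIcc ρ j) = ∏ j ∈ Icc 1 d, f j := by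
  refine (permIcc ρ).prod_comp _ f fun j hj => ?_
  by_contra h
  exact hj (permIcc_of_notMem ρ h)

theorem prod_ne_permIcc {M : Type*} [CommMonoid M] {d : ℕ} (ρ : Equiv.Perm (Fin d))
    (f : ℕ → ℕ → M) :
    ∏ ij ∈ ((Icc 1 d) ×ˢ (Icc 1 d)).filter (fun ij => ij.1 ≠ ij.2),
        f (permIcc ρ ij.1) (permIcc ρ ij.2) =
      ∏ ij ∈ ((Icc 1 d) ×ˢ (Icc 1 d)).filter (fun ij => ij.1 ≠ ij.2), f ij.1 ij.2 := by
  refine prod_equiv ((permIcc ρ).prodCongr (permIcc ρ)) (fun ij => ?_) fun ij _ => rfl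
  simp only [mem_filter, mem_product, Equiv.prodCongr_apply, Prod.map_fst, Prod.map_snd,
    permIcc_mem, ne_eq, EmbeddingLike.apply_eq_iff_eq]

theorem prod_lt_Icc_eq_det_vandermonde {R : Type*} [CommRing R] (d : ℕ) (x : ℕ → R) :
    ∏ ij ∈ ((Icc 1 d) ×ˢ (Icc 1 d)).filter (fun ij => ij.1 < ij.2), (x ij.2 - x ij.1) =
      (Matrix.vandermonde fun i : Fin d => x (i + 1)).det := by
  rw [Matrix.det_vandermonde, Finset.prod_sigma']
  symm
  refine prod_nbij (fun s => ((s.1 : ℕ) + 1, (s.2 : ℕ) + 1)) ?_ ?_ ?_ ?_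
  · rintro ⟨i, j⟩ h
    simp only [mem_sigma, mem_univ, mem_Ioi, true_and, Fin.lt_def] at h
    simp only [mem_filter, mem_product, mem_Icc]
    omega
  · rintro ⟨i, j⟩ _ ⟨i', j'⟩ _ h
    simp only [Prod.mk.injEq, Nat.add_right_cancel_iff, Fin.val_inj] at h
    obtain ⟨rfl, rfl⟩ := h
    rfl
  · rintro ⟨i, j⟩ h
    simp only [coe_filter, mem_product, mem_Icc, Set.mem_ofPred_eq] at h
    refine ⟨⟨⟨i - 1, by omega⟩, ⟨j - 1, by omega⟩⟩, ?_, ?_⟩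
    · simp only [coe_sigma, Set.mem_sigma_iff, mem_coe, mem_univ, mem_Ioi, true_and, Fin.lt_def]
      omega
    · simp only [Prod.mk.injEq]
      omega
  · rintro ⟨i, j⟩ _
    rfl

theorem prod_lt_permIcc {R : Type*} [CommRing R] {d : ℕ} (ρ : Equiv.Perm (Fin d)) (x : ℕ → R) :
    ∏ ij ∈ ((Icc 1 d) ×ˢ (Icc 1 d)).filter (fun ij => ij.1 < ij.2),
        (x (permIcc ρ ij.2) - x (permIcc ρ ij.1)) =
      (Equiv.Perm.sign ρ : ℤ) *
        ∏ ij ∈ ((Icc 1 d) ×ˢ (Icc 1 d)).filter (fun ij => ij.1 < ij.2), (x ij.2 - x ij.1) := by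
  rw [prod_lt_Icc_eq_det_vandermonde, prod_lt_Icc_eq_det_vandermonde d fun j => x (permIcc ρ j),
    ← Matrix.det_permute]
  congr 1
  ext i j
  simp [Matrix.vandermonde_apply, permIcc_succ]

/-- The permutation of `ℕ × ℕ` acting on the `m`-th block `{(m, j) | 1 ≤ j ≤ v m}` as `ρ m`. -/
def blockPerm {v : ℕ → ℕ} (ρ : ∀ m, Equiv.Perm (Fin (v m))) : Equiv.Perm (ℕ × ℕ) :=
  Equiv.prodShear (Equiv.refl ℕ) fun m => permIcc (ρ m)

theorem blockPerm_apply {v : ℕ → ℕ} (ρ : ∀ m, Equiv.Perm (Fin (v m))) (m j : ℕ) :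
    blockPerm ρ (m, j) = (m, permIcc (ρ m) j) := rfl

theorem blockPerm_mem {N : ℕ} {v : ℕ → ℕ} (ρ : ∀ m, Equiv.Perm (Fin (v m))) {x : ℕ × ℕ} :
    blockPerm ρ x ∈ blockIndices N v ↔ x ∈ blockIndices N v := by
  obtain ⟨m, j⟩ := x
  simp only [mem_blockIndices, blockPerm_apply, permIcc_mem]

/-- The product of the signs of `ρ 1, …, ρ N`. -/
def blockSign (N : ℕ) {v : ℕ → ℕ} (ρ : ∀ m, Equiv.Perm (Fin (v m))) : ℤ :=
  ∏ m ∈ Icc 1 N, (Equiv.Perm.sign (ρ m) : ℤ)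

theorem rename_blockVandermonde (R : Type*) [CommRing R] (N : ℕ) {v : ℕ → ℕ}
    (ρ : ∀ m, Equiv.Perm (Fin (v m))) :
    rename (blockPerm ρ) (blockVandermonde R N v) =
      blockSign N ρ * blockVandermonde R N v := by
  simp only [blockVandermonde, map_prod, map_sub, rename_X, blockPerm_apply, blockSign,
    Int.cast_prod, ← prod_mul_distrib]
  exact prod_congr rfl fun m _ => prod_lt_permIcc (ρ m) fun j => X (m, j)

theorem dimv_self {k n : ℕ} (hn : 2 * k ≤ n) : dimv k n k = k := by
  unfold dimv; omega

theorem dimv_sub_self {k n : ℕ} (hn : 2 * k ≤ n) : dimv k n (n - k) = k := by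
  unfold dimv; omega

theorem rename_superpotential {R : Type*} [CommRing R] {k n : ℕ} (hn : 2 * k ≤ n) (a b c : ℕ)
    (z q : R) (ρ : ∀ m, Equiv.Perm (Fin (dimv k n m))) :
    rename (blockPerm ρ) (superpotential k n a b c z q) = superpotential k n a b c z q := by
  have key : ∀ (m : ℕ) (_ : dimv k n m = k) (f : ℕ → MvPolynomial (ℕ × ℕ) R),
      ∏ i ∈ Icc 1 k, f (permIcc (ρ m) i) = ∏ i ∈ Icc 1 k, f i := by
    intro m hm f
    rw [show Icc 1 k = Icc 1 (dimv k n m) by rw [hm]]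
    exact prod_permIcc (ρ m) f
  let Ψ : MvPolynomial (ℕ × ℕ) R →ₐ[R] MvPolynomial (ℕ × ℕ) R := rename (blockPerm ρ)
  change Ψ _ = _
  have hX : ∀ x, Ψ (X x) = X (blockPerm ρ x) := rename_X _
  have hC : ∀ r, Ψ (C r) = C r := rename_C _
  simp only [superpotential, map_mul Ψ, map_pow Ψ, map_prod Ψ, map_sub Ψ, map_one Ψ, hX, hC, blockPerm_apply, prod_mul_distrib]
  refine congrArg₂ _ (congrArg₂ _ (congrArg₂ _ (congrArg (· ^ a) ?_) ?_) ?_) (congrArg₂ _ ?_ ?_)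
  · exact prod_congr rfl fun m _ => prod_permIcc (ρ m) fun j => X (m, j)
  · exact prod_congr rfl fun m _ => prod_ne_permIcc (ρ m) fun i j =>
      ∏ r ∈ range b, (X (m, i) - C (q ^ r) * X (m, j))
  · refine prod_congr rfl fun m _ => ?_
    rw [prod_permIcc (ρ m) fun i => ∏ j ∈ Icc 1 (dimv k n (m + 1)), ∏ r ∈ range c,
      (X (m, i) - C (q ^ r) * X (m + 1, permIcc (ρ (m + 1)) j))]
    exact prod_congr rfl fun i _ => prod_permIcc (ρ (m + 1)) fun j => ∏ r ∈ range c,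
      (X (m, i) - C (q ^ r) * X (m + 1, j))
  · exact key k (dimv_self hn) fun i => ∏ r ∈ range c, (C z - C (q ^ r) * X (k, i))
  · exact key (n - k) (dimv_sub_self hn) fun i =>
      ∏ r ∈ range c, (1 - C (q ^ r) * X (n - k, i))

/-- The exponent vector `ℓ d + (ℓ - 1) 𝟙_S`. -/
noncomputable def cartierExp {σ : Type*} (ℓ : ℕ) (S : Finset σ) (d : σ →₀ ℕ) : σ →₀ ℕ :=
  ℓ • d + Finsupp.indicator S fun _ _ => ℓ - 1

theorem cartierExp_apply_mem {σ : Type*} (ℓ : ℕ) {S : Finset σ} (d : σ →₀ ℕ) {x : σ}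
    (hx : x ∈ S) : cartierExp ℓ S d x = ℓ * d x + (ℓ - 1) := by
  simp [cartierExp, Finsupp.indicator_of_mem hx]

theorem cartierExp_apply_notMem {σ : Type*} (ℓ : ℕ) {S : Finset σ} (d : σ →₀ ℕ) {x : σ}
    (hx : x ∉ S) : cartierExp ℓ S d x = ℓ * d x := by
  simp [cartierExp, Finsupp.indicator_of_notMem hx]

theorem cartierExp_div {σ : Type*} {ℓ : ℕ} (hℓ : 0 < ℓ) (S : Finset σ) (d : σ →₀ ℕ) (x : σ) :
    cartierExp ℓ S d x / ℓ = d x := by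
  by_cases hx : x ∈ S
  · rw [cartierExp_apply_mem ℓ d hx, Nat.mul_add_div hℓ, Nat.div_eq_of_lt (by omega), add_zero]
  · rw [cartierExp_apply_notMem ℓ d hx, Nat.mul_div_cancel_left _ hℓ]

/-- The Cartier operator: the polynomial whose coefficients are those of `P` at the exponents
congruent to `-1` modulo `ℓ` in the variables of `S` and to `0` in the other variables. -/
noncomputable def cartier {σ R : Type*} [CommSemiring R] (ℓ : ℕ) (S : Finset σ)
    (P : MvPolynomial σ R) : MvPolynomial σ R :=
  open Classical in
  ∑ d ∈ P.support.image (Finsupp.mapRange (· / ℓ) (Nat.zero_div ℓ)),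
    monomial d (coeff (cartierExp ℓ S d) P)

theorem coeff_cartier {σ R : Type*} [CommSemiring R] {ℓ : ℕ} (hℓ : 0 < ℓ) (S : Finset σ)
    (P : MvPolynomial σ R) (d : σ →₀ ℕ) :
    coeff d (cartier ℓ S P) = coeff (cartierExp ℓ S d) P := by
  classical
  simp only [cartier, coeff_sum, coeff_monomial, sum_ite_eq']
  split_ifs with h
  · rfl
  · by_contra hne
    refine h (mem_image.2 ⟨_, mem_support_iff.2 (Ne.symm hne), ?_⟩)
    ext x
    exact cartierExp_div hℓ S d x

theorem cartier_mul_expand {σ R : Type*} [CommSemiring R] {ℓ : ℕ} (hℓ : 0 < ℓ) (S : Finset σ)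
    (P Q : MvPolynomial σ R) : cartier ℓ S (P * expand ℓ Q) = cartier ℓ S P * Q := by
  ext d
  rw [coeff_cartier hℓ]
  induction Q using MvPolynomial.induction_on' with
  | monomial u a =>
    rw [expand_monomial, coeff_mul_monomial', coeff_mul_monomial', coeff_cartier hℓ]
    have hle : ℓ • u ≤ cartierExp ℓ S d ↔ u ≤ d := by
      refine forall_congr' fun x => ?_
      rw [← cartierExp_div hℓ S d x, Nat.le_div_iff_mul_le hℓ, Finsupp.smul_apply, smul_eq_mul,
        mul_comm]
    simp only [hle]
    split_ifs with h
    · congr 2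
      ext x
      have hx := Nat.mul_le_mul_left ℓ (h x)
      by_cases hS : x ∈ S
      · simp only [Finsupp.tsub_apply, Finsupp.smul_apply, smul_eq_mul,
          cartierExp_apply_mem ℓ _ hS, Nat.mul_sub]
        omega
      · simp only [Finsupp.tsub_apply, Finsupp.smul_apply, smul_eq_mul,
          cartierExp_apply_notMem ℓ _ hS, Nat.mul_sub]
    · rfl
  | add Q₁ Q₂ h₁ h₂ => rw [map_add, mul_add, mul_add, coeff_add, coeff_add, h₁, h₂]

/-- Sign-equivariance of the coefficients under permutations of the variables in each block. -/
def IsBlockAlternating {R : Type*} [CommRing R] (N : ℕ) (v : ℕ → ℕ)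
    (P : MvPolynomial (ℕ × ℕ) R) : Prop :=
  ∀ (ρ : ∀ m, Equiv.Perm (Fin (v m))) (d : ℕ × ℕ →₀ ℕ),
    coeff (d.mapDomain (blockPerm ρ)) P = blockSign N ρ * coeff d P

section Alternating

variable {R : Type*} [CommRing R] {N : ℕ} {v : ℕ → ℕ}

theorem isBlockAlternating_of_rename {P : MvPolynomial (ℕ × ℕ) R}
    (h : ∀ ρ : ∀ m, Equiv.Perm (Fin (v m)), rename (blockPerm ρ) P = blockSign N ρ * P) :
    IsBlockAlternating N v P := by
  intro ρ d
  have hsq : (blockSign N ρ : R) * blockSign N ρ = 1 := by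
    rw [← Int.cast_mul, blockSign, ← prod_mul_distrib,
      prod_eq_one fun m _ => Int.units_coe_mul_self _, Int.cast_one]
  rw [← coeff_rename_mapDomain (blockPerm ρ) (blockPerm ρ).injective P d, h ρ,
    ← map_intCast (C : R →+* MvPolynomial (ℕ × ℕ) R), coeff_C_mul, ← mul_assoc, hsq, one_mul]

theorem mapDomain_cartierExp (ℓ : ℕ) (ρ : ∀ m, Equiv.Perm (Fin (v m))) (d : ℕ × ℕ →₀ ℕ) :
    (cartierExp ℓ (blockIndices N v) d).mapDomain (blockPerm ρ) =
      cartierExp ℓ (blockIndices N v) (d.mapDomain (blockPerm ρ)) := by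
  ext x
  obtain ⟨y, rfl⟩ := (blockPerm ρ).surjective x
  by_cases hy : y ∈ blockIndices N v
  · rw [cartierExp_apply_mem _ _ ((blockPerm_mem ρ).2 hy)]
    simp [Finsupp.mapDomain_equiv_apply, cartierExp_apply_mem _ _ hy]
  · rw [cartierExp_apply_notMem _ _ (mt (blockPerm_mem ρ).1 hy)]
    simp [Finsupp.mapDomain_equiv_apply, cartierExp_apply_notMem _ _ hy]

theorem IsBlockAlternating.cartier {P : MvPolynomial (ℕ × ℕ) R} (h : IsBlockAlternating N v P)
    {ℓ : ℕ} (hℓ : 0 < ℓ) : IsBlockAlternating N v (cartier ℓ (blockIndices N v) P) := by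
  intro ρ d
  rw [coeff_cartier hℓ, coeff_cartier hℓ, ← mapDomain_cartierExp, h]

theorem IsBlockAlternating.C_mul {P : MvPolynomial (ℕ × ℕ) R} (h : IsBlockAlternating N v P)
    (r : R) : IsBlockAlternating N v (C r * P) := by
  intro ρ d
  rw [coeff_C_mul, coeff_C_mul, h, mul_left_comm]

theorem IsBlockAlternating.sub {P Q : MvPolynomial (ℕ × ℕ) R} (hP : IsBlockAlternating N v P)
    (hQ : IsBlockAlternating N v Q) : IsBlockAlternating N v (P - Q) := by
  intro ρ d
  rw [coeff_sub, coeff_sub, hP, hQ, mul_sub]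

/-- All monomials of `P` have degree less than `v m` in the variables of the `m`-th block, and
involve no variables outside of the blocks. -/
def IsBlockBounded (N : ℕ) (v : ℕ → ℕ) (P : MvPolynomial (ℕ × ℕ) R) : Prop :=
  ∀ d, coeff d P ≠ 0 → (∀ x ∉ blockIndices N v, d x = 0) ∧ ∀ x ∈ blockIndices N v, d x < v x.1

theorem IsBlockBounded.C_mul {P : MvPolynomial (ℕ × ℕ) R} (h : IsBlockBounded N v P)
    (r : R) : IsBlockBounded N v (C r * P) := by
  intro d hd
  rw [coeff_C_mul] at hd
  exact h d (right_ne_zero_of_mul hd)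

theorem IsBlockBounded.sub {P Q : MvPolynomial (ℕ × ℕ) R} (hP : IsBlockBounded N v P)
    (hQ : IsBlockBounded N v Q) : IsBlockBounded N v (P - Q) := by
  intro d hd
  by_cases h : coeff d P = 0
  · refine hQ d fun h' => hd ?_
    rw [coeff_sub, h, h', sub_zero]
  · exact hP d h

theorem IsBlockAlternating.coeff_eq_zero [IsDomain R] [CharZero R] {P : MvPolynomial (ℕ × ℕ) R}
    (h : IsBlockAlternating N v P) {m : ℕ} (hm : m ∈ Icc 1 N) {i j : Fin (v m)} (hij : i ≠ j)
    {d : ℕ × ℕ →₀ ℕ} (hd : d (m, (i : ℕ) + 1) = d (m, (j : ℕ) + 1)) : coeff d P = 0 := by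
  classical
  let ρ : ∀ m, Equiv.Perm (Fin (v m)) := Function.update (fun _ => 1) m (Equiv.swap i j)
  have hρ : ρ m = Equiv.swap i j := Function.update_self ..
  have hρ' : ∀ m', m' ≠ m → ρ m' = 1 := fun m' hm' => Function.update_of_ne hm' ..
  have hsign : blockSign N ρ = -1 := by
    rw [blockSign, prod_eq_single_of_mem m hm fun m' _ hm' => by simp [hρ' m' hm'], hρ,
      Equiv.Perm.sign_swap hij]
    rfl
  have hinv : ∀ y, d (blockPerm ρ y) = d y := by
    rintro ⟨m', a⟩
    rw [blockPerm_apply]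
    by_cases ha : a ∈ Icc 1 (v m')
    · obtain ⟨a, rfl⟩ : ∃ b : Fin (v m'), (b : ℕ) + 1 = a :=
        ⟨⟨a - 1, by have := mem_Icc.1 ha; omega⟩, by have := mem_Icc.1 ha; simp only; omega⟩
      rw [permIcc_succ]
      by_cases hm' : m' = m
      · subst hm'
        rw [hρ, Equiv.swap_apply_def]
        split_ifs with h₁ h₂
        · rw [h₁, hd]
        · rw [h₂, hd]
        · rfl
      · rw [hρ' m' hm', Equiv.Perm.one_apply]
    · rw [permIcc_of_notMem _ ha]
  have hfix : d.mapDomain (blockPerm ρ) = d := by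
    ext x
    obtain ⟨y, rfl⟩ := (blockPerm ρ).surjective x
    rw [Finsupp.mapDomain_equiv_apply, Equiv.symm_apply_apply, hinv]
  have := h ρ d
  rw [hfix, hsign] at this
  push_cast at this
  rw [neg_one_mul] at this
  exact self_eq_neg.1 this

theorem IsBlockAlternating.eq_zero [IsDomain R] [CharZero R] {P : MvPolynomial (ℕ × ℕ) R}
    (h : IsBlockAlternating N v P) (hb : IsBlockBounded N v P) {d₀ : ℕ × ℕ →₀ ℕ}
    (hd₀ : ∀ x ∉ blockIndices N v, d₀ x = 0) (hd₀' : ∀ x ∈ blockIndices N v, d₀ x = x.2 - 1)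
    (hP : coeff d₀ P = 0) : P = 0 := by
  ext d
  rw [coeff_zero]
  by_contra hd
  obtain ⟨hout, hin⟩ := hb d hd
  have hmem : ∀ m ∈ Icc 1 N, ∀ i : Fin (v m), (m, (i : ℕ) + 1) ∈ blockIndices N v :=
    fun m hm i => mem_blockIndices.2 ⟨hm, mem_Icc.2 ⟨by simp, i.2⟩⟩
  have hρ : ∀ m, ∃ ρ : Equiv.Perm (Fin (v m)), m ∈ Icc 1 N →
      ∀ i, (ρ i : ℕ) = d (m, (i : ℕ) + 1) := by
    intro m
    by_cases hm : m ∈ Icc 1 N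
    · let g : Fin (v m) → Fin (v m) := fun i => ⟨d (m, (i : ℕ) + 1), hin _ (hmem m hm i)⟩
      have hg : Function.Injective g := by
        intro i j hij
        by_contra hne
        exact hd (h.coeff_eq_zero hm hne (congrArg Fin.val hij))
      exact ⟨Equiv.ofBijective g (Finite.injective_iff_bijective.1 hg), fun _ _ => rfl⟩
    · exact ⟨1, fun hm' => absurd hm' hm⟩
  choose ρ hρ using hρ
  have hsort : d.mapDomain (blockPerm ρ) = d₀ := by
    ext x
    obtain ⟨y, rfl⟩ := (blockPerm ρ).surjective x
    rw [Finsupp.mapDomain_equiv_apply, Equiv.symm_apply_apply]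
    by_cases hy : y ∈ blockIndices N v
    · rw [hd₀' _ ((blockPerm_mem ρ).2 hy)]
      obtain ⟨m, a⟩ := y
      obtain ⟨hm, ha⟩ : m ∈ Icc 1 N ∧ a ∈ Icc 1 (v m) := mem_blockIndices.1 hy
      obtain ⟨a, rfl⟩ : ∃ b : Fin (v m), (b : ℕ) + 1 = a :=
        ⟨⟨a - 1, by have := mem_Icc.1 ha; omega⟩, by have := mem_Icc.1 ha; simp only; omega⟩
      rw [blockPerm_apply, permIcc_succ, Nat.add_sub_cancel, hρ m hm]
    · rw [hd₀ _ (mt (blockPerm_mem ρ).1 hy), hout y hy]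
  have hz := h ρ d
  rw [hsort, hP] at hz
  rcases mul_eq_zero.1 hz.symm with h0 | h0
  · rw [Int.cast_eq_zero, blockSign, prod_eq_zero_iff] at h0
    obtain ⟨m, -, hm⟩ := h0
    exact (Equiv.Perm.sign (ρ m)).ne_zero hm
  · exact hd h0

end Alternating

section Degree

variable {R : Type*} [CommRing R] [Nontrivial R]

theorem degreeOf_X_sub_C_mul_X_le (x u w : ℕ × ℕ) (r : R) :
    degreeOf x (X u - C r * X w) ≤ (if x = u then 1 else 0) + (if x = w then 1 else 0) := by
  refine (degreeOf_sub_le _ _ _).trans (max_le ?_ ?_)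
  · rw [degreeOf_X]
    exact Nat.le_add_right _ _
  · refine (degreeOf_C_mul_le _ _ _).trans ?_
    rw [degreeOf_X]
    exact Nat.le_add_left _ _

theorem degreeOf_C_sub_C_mul_X_le (x u : ℕ × ℕ) (r r' : R) :
    degreeOf x (C r' - C r * X u) ≤ if x = u then 1 else 0 := by
  refine (degreeOf_sub_le _ _ _).trans (max_le ?_ ?_)
  · rw [degreeOf_C]
    exact Nat.zero_le _
  · refine (degreeOf_C_mul_le _ _ _).trans ?_
    rw [degreeOf_X]

theorem degreeOf_prod_le_sum {A ι σ : Type*} [CommSemiring A] {x : σ} {s : Finset ι}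
    {f : ι → MvPolynomial σ A} {g : ι → ℕ} (h : ∀ i ∈ s, degreeOf x (f i) ≤ g i) :
    degreeOf x (∏ i ∈ s, f i) ≤ ∑ i ∈ s, g i :=
  (degreeOf_prod_le _ _ _).trans (sum_le_sum h)

theorem degreeOf_prod_range_le {A σ : Type*} [CommSemiring A] {x : σ} {c : ℕ}
    {f : ℕ → MvPolynomial σ A} {e : ℕ} (h : ∀ r, degreeOf x (f r) ≤ e) :
    degreeOf x (∏ r ∈ range c, f r) ≤ c * e := by
  refine (degreeOf_prod_le_sum fun r _ => h r).trans ?_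
  simp

theorem sum_filter_ne_ite {s : Finset ℕ} {j : ℕ} (hj : j ∈ s) :
    ∑ ij ∈ (s ×ˢ s).filter (fun ij => ij.1 ≠ ij.2), (if j = ij.1 then 1 else 0) = #s - 1 := by
  rw [← card_filter, ← card_erase_of_mem hj]
  refine card_nbij' Prod.snd (Prod.mk j) ?_ ?_ ?_ ?_ <;>
    (simp only [Set.MapsTo, Set.LeftInvOn, mem_coe]
     grind)

theorem sum_filter_ne_ite_snd {s : Finset ℕ} {j : ℕ} (hj : j ∈ s) :
    ∑ ij ∈ (s ×ˢ s).filter (fun ij => ij.1 ≠ ij.2), (if j = ij.2 then 1 else 0) = #s - 1 := by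
  rw [← card_filter, ← card_erase_of_mem hj]
  refine card_nbij' Prod.fst (fun i => (i, j)) ?_ ?_ ?_ ?_ <;>
    (simp only [Set.MapsTo, Set.LeftInvOn, mem_coe]
     grind)

theorem sum_filter_lt_ite {s : Finset ℕ} {j : ℕ} (hj : j ∈ s) :
    ∑ ij ∈ (s ×ˢ s).filter (fun ij => ij.1 < ij.2),
      ((if j = ij.2 then 1 else 0) + (if j = ij.1 then 1 else 0)) = #s - 1 := by
  rw [sum_add_distrib, ← card_filter, ← card_filter, ← card_erase_of_mem hj,
    ← card_filter_add_card_filter_not (s := s.erase j) (fun i => i < j)]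
  congr 1
  · refine card_nbij' Prod.fst (fun i => (i, j)) ?_ ?_ ?_ ?_ <;>
    (simp only [Set.MapsTo, Set.LeftInvOn, mem_coe]
     grind)
  · refine card_nbij' Prod.snd (Prod.mk j) ?_ ?_ ?_ ?_ <;>
    (simp only [Set.MapsTo, Set.LeftInvOn, mem_coe]
     grind)

theorem degreeOf_blockVandermonde_le {N : ℕ} {v : ℕ → ℕ} {m j : ℕ}
    (hx : (m, j) ∈ blockIndices N v) :
    degreeOf (m, j) (blockVandermonde R N v) ≤ v m - 1 := by
  obtain ⟨hm, hj⟩ : m ∈ Icc 1 N ∧ j ∈ Icc 1 (v m) := mem_blockIndices.1 hx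
  rw [blockVandermonde]
  refine (degreeOf_prod_le _ _ _).trans ?_
  refine (sum_le_sum fun m' _ => (degreeOf_prod_le _ _ _).trans <| sum_le_sum fun ij _ =>
    show _ ≤ (if (m, j) = (m', ij.2) then 1 else 0) + (if (m, j) = (m', ij.1) then 1 else 0) from
    ?_).trans ?_
  · simpa using degreeOf_X_sub_C_mul_X_le (m, j) (m', ij.2) (m', ij.1) (1 : R)
  · rw [sum_eq_single_of_mem m hm]
    · simp only [Prod.mk.injEq, true_and]
      rw [sum_filter_lt_ite hj]
      simp
    · intro m' _ hm'
      simp [Ne.symm hm']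

theorem blockVandermonde_mem_supported (N : ℕ) (v : ℕ → ℕ) :
    blockVandermonde R N v ∈ supported R (blockIndices N v : Set (ℕ × ℕ)) := by
  refine prod_mem fun m hm => prod_mem fun ij hij => ?_
  simp only [mem_filter, mem_product] at hij
  exact sub_mem (X_mem_supported.2 (mem_blockIndices.2 ⟨hm, hij.1.2⟩))
    (X_mem_supported.2 (mem_blockIndices.2 ⟨hm, hij.1.1⟩))

theorem superpotential_mem_supported {k n : ℕ} (hk : 1 ≤ k) (hn : 2 * k ≤ n) (a b c : ℕ)
    (z q : R) :
    superpotential k n a b c z q ∈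
      supported R (blockIndices (n - 1) (dimv k n) : Set (ℕ × ℕ)) := by
  have hC : ∀ r : R, C r ∈ supported R (blockIndices (n - 1) (dimv k n) : Set (ℕ × ℕ)) :=
    fun r => Subalgebra.algebraMap_mem _ r
  have hX : ∀ m j, 1 ≤ m → j ∈ Icc 1 (dimv k n m) →
      (X (m, j) : MvPolynomial (ℕ × ℕ) R) ∈
        supported R (blockIndices (n - 1) (dimv k n) : Set (ℕ × ℕ)) := by
    intro m j hm hj
    refine X_mem_supported.2 (mem_blockIndices.2 ⟨mem_Icc.2 ⟨hm, ?_⟩, hj⟩)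
    simp only [mem_Icc, dimv] at hj
    simp only
    omega
  refine mul_mem (mul_mem (mul_mem (pow_mem ?_ _) ?_) ?_) ?_
  · exact prod_mem fun m hm => prod_mem fun j hj => hX m j (mem_Icc.1 hm).1 hj
  · refine prod_mem fun m hm => prod_mem fun ij hij => prod_mem fun r _ => ?_
    simp only [mem_filter, mem_product] at hij
    exact sub_mem (hX _ _ (mem_Icc.1 hm).1 hij.1.1)
      (mul_mem (hC _) (hX _ _ (mem_Icc.1 hm).1 hij.1.2))
  · exact prod_mem fun m hm => prod_mem fun i hi => prod_mem fun j hj => prod_mem fun r _ =>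
      sub_mem (hX _ _ (mem_Icc.1 hm).1 hi) (mul_mem (hC _) (hX _ _ (by omega) hj))
  · refine prod_mem fun i hi => prod_mem fun r _ => mul_mem (sub_mem (hC _) (mul_mem (hC _) ?_))
      (sub_mem (one_mem _) (mul_mem (hC _) ?_))
    · exact hX _ _ hk (by rwa [dimv_self hn])
    · exact hX _ _ (by omega) (by rwa [dimv_sub_self hn])

theorem degreeOf_monomial_factor_le {N : ℕ} {v : ℕ → ℕ} {m j : ℕ}
    (hx : (m, j) ∈ blockIndices N v) (a : ℕ) :
    degreeOf (m, j) ((∏ m ∈ Icc 1 N, ∏ j ∈ Icc 1 (v m),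
      (X (m, j) : MvPolynomial (ℕ × ℕ) R)) ^ a) ≤ a := by
  obtain ⟨hm, hj⟩ : m ∈ Icc 1 N ∧ j ∈ Icc 1 (v m) := mem_blockIndices.1 hx
  refine (degreeOf_pow_le _ _ _).trans ((Nat.mul_le_mul_left a ?_).trans_eq (mul_one a))
  refine (degreeOf_prod_le_sum (g := fun m' => if m = m' then 1 else 0)
    fun m' _ => (degreeOf_prod_le_sum (g := fun j' => if (m, j) = (m', j') then 1 else 0)
      fun j' _ => (degreeOf_X _ _).le).trans ?_).trans ?_
  · split_ifs with h
    · subst h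
      simp only [Prod.mk.injEq, true_and, sum_ite_eq]
      split_ifs
      simp
    · simp [h]
  · rw [sum_ite_eq]
    split_ifs
    simp

theorem degreeOf_diagonal_factor_le {N : ℕ} {v : ℕ → ℕ} {m j : ℕ}
    (hx : (m, j) ∈ blockIndices N v) (b : ℕ) (q : R) :
    degreeOf (m, j) (∏ m ∈ Icc 1 N,
      ∏ ij ∈ ((Icc 1 (v m)) ×ˢ (Icc 1 (v m))).filter (fun ij => ij.1 ≠ ij.2),
        ∏ r ∈ range b, (X (m, ij.1) - C (q ^ r) * X (m, ij.2))) ≤ b * (2 * (v m - 1)) := by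
  obtain ⟨hm, hj⟩ : m ∈ Icc 1 N ∧ j ∈ Icc 1 (v m) := mem_blockIndices.1 hx
  have hblock (m' : ℕ) : degreeOf (m, j)
      (∏ ij ∈ ((Icc 1 (v m')) ×ˢ (Icc 1 (v m'))).filter (fun ij => ij.1 ≠ ij.2),
        ∏ r ∈ range b, (X (m', ij.1) - C (q ^ r) * X (m', ij.2))) ≤
      if m = m' then b * (2 * (v m - 1)) else 0 := by
    have hpair (ij : ℕ × ℕ) : degreeOf (m, j) (∏ r ∈ range b,
        (X (m', ij.1) - C (q ^ r) * X (m', ij.2))) ≤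
        b * ((if (m, j) = (m', ij.1) then 1 else 0) + if (m, j) = (m', ij.2) then 1 else 0) :=
      degreeOf_prod_range_le fun r => degreeOf_X_sub_C_mul_X_le _ _ _ _
    refine (degreeOf_prod_le_sum fun ij _ => hpair ij).trans ?_
    rw [← mul_sum, sum_add_distrib]
    split_ifs with h
    · subst h
      simp only [Prod.mk.injEq, true_and]
      rw [sum_filter_ne_ite hj, sum_filter_ne_ite_snd hj, two_mul, Nat.card_Icc,
        Nat.add_sub_cancel]
    · simp [h]
  refine (degreeOf_prod_le_sum fun m' _ => hblock m').trans ?_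
  rw [sum_ite_eq]
  split_ifs
  simp

theorem degreeOf_arrow_factor_le {N : ℕ} {v : ℕ → ℕ} {m j : ℕ} (hm : 1 ≤ m) (c : ℕ) (q : R) :
    degreeOf (m, j) (∏ i ∈ Icc 1 N, ∏ a ∈ Icc 1 (v i), ∏ b ∈ Icc 1 (v (i + 1)),
      ∏ r ∈ range c, (X (i, a) - C (q ^ r) * X (i + 1, b))) ≤ c * (v (m + 1) + v (m - 1)) := by
  refine (degreeOf_prod_le_sum (g := fun i => c * ((if m = i then v (m + 1) else 0) +
      if m - 1 = i then v (m - 1) else 0)) fun i _ =>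
    (degreeOf_prod_le_sum (g := fun a => ∑ b ∈ Icc 1 (v (i + 1)),
      c * ((if (m, j) = (i, a) then 1 else 0) + if (m, j) = (i + 1, b) then 1 else 0)) fun a _ =>
      degreeOf_prod_le_sum fun b _ => degreeOf_prod_range_le
      fun r => degreeOf_X_sub_C_mul_X_le _ _ _ _).trans ?_).trans ?_
  · simp only [← mul_sum, sum_add_distrib]
    refine Nat.mul_le_mul_left c (add_le_add ?_ ?_)
    · split_ifs with h
      · subst h
        rw [sum_comm]
        simp only [Prod.mk.injEq, true_and, sum_ite_eq, sum_const, Nat.card_Icc, smul_eq_mul]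
        split_ifs <;> simp
      · simp [h]
    · split_ifs with h
      · subst h
        rw [Nat.sub_add_cancel hm]
        simp only [Prod.mk.injEq, true_and, sum_ite_eq, sum_const, Nat.card_Icc, smul_eq_mul]
        split_ifs <;> simp
      · have : m ≠ i + 1 := by omega
        simp [this]
  · rw [← mul_sum, sum_add_distrib, sum_ite_eq, sum_ite_eq]
    refine Nat.mul_le_mul_left c (add_le_add ?_ ?_) <;> split_ifs <;> simp

theorem degreeOf_framing_factor_le {k l m j : ℕ} (c : ℕ) (z q : R) :
    degreeOf (m, j) (∏ i ∈ Icc 1 k, ∏ r ∈ range c,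
      (C z - C (q ^ r) * X (k, i)) * (1 - C (q ^ r) * X (l, i))) ≤
        c * ((if m = k then 1 else 0) + if m = l then 1 else 0) := by
  refine (degreeOf_prod_le_sum (g := fun i => c * ((if (m, j) = (k, i) then 1 else 0) +
    if (m, j) = (l, i) then 1 else 0)) fun i _ => degreeOf_prod_range_le
      fun r => (degreeOf_mul_le _ _ _).trans <| add_le_add (degreeOf_C_sub_C_mul_X_le _ _ _ _)
      ?_).trans ?_
  · simpa using degreeOf_C_sub_C_mul_X_le (m, j) (l, i) (q ^ r) 1
  · have (u : ℕ) : ∑ i ∈ Icc 1 k, (if (m, j) = (u, i) then 1 else 0) ≤ if m = u then 1 else 0 := by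
      split_ifs with h
      · subst h
        simp only [Prod.mk.injEq, true_and, sum_ite_eq]
        split_ifs <;> simp
      · simp [h]
    rw [← mul_sum, sum_add_distrib]
    exact Nat.mul_le_mul_left c (add_le_add (this k) (this l))

theorem degreeOf_superpotential_le {k n : ℕ} (hk : 1 ≤ k) (hn : 2 * k ≤ n) (a b c : ℕ)
    (z q : R) {m j : ℕ} (hx : (m, j) ∈ blockIndices (n - 1) (dimv k n)) :
    degreeOf (m, j) (superpotential k n a b c z q) ≤
      a + b * (2 * (dimv k n m - 1)) + c * (2 * dimv k n m) := by
  have hm : 1 ≤ m ∧ m ≤ n - 1 := mem_Icc.1 (mem_blockIndices.1 hx).1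
  have hbalance : dimv k n (m + 1) + dimv k n (m - 1) +
      ((if m = k then 1 else 0) + if m = n - k then 1 else 0) = 2 * dimv k n m := by
    unfold dimv
    split_ifs <;> omega
  rw [← hbalance, mul_add, ← add_assoc, superpotential]
  refine (degreeOf_mul_le _ _ _).trans (add_le_add ((degreeOf_mul_le _ _ _).trans
    (add_le_add ((degreeOf_mul_le _ _ _).trans (add_le_add ?_ ?_)) ?_)) ?_)
  · exact degreeOf_monomial_factor_le hx a
  · exact degreeOf_diagonal_factor_le hx b q
  · exact degreeOf_arrow_factor_le hm.1 c q
  · exact degreeOf_framing_factor_le c z q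

end Degree

section Bounded

variable {R : Type*} [CommRing R] {N : ℕ} {v : ℕ → ℕ}

theorem apply_eq_zero_of_mem_supported {σ A : Type*} [CommSemiring A] {P : MvPolynomial σ A}
    {S : Set σ} (hP : P ∈ supported A S) {d : σ →₀ ℕ} (hd : coeff d P ≠ 0) {x : σ} (hx : x ∉ S) :
    d x = 0 := by
  by_contra h
  exact hx (mem_supported.1 hP (mem_coe.2 ((mem_vars_iff_mem_support x).2
    ⟨d, mem_support_iff.2 hd, Finsupp.mem_support_iff.2 h⟩)))

theorem isBlockBounded_of_degreeOf_lt {P : MvPolynomial (ℕ × ℕ) R}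
    (hP : P ∈ supported R (blockIndices N v : Set (ℕ × ℕ)))
    (h : ∀ x ∈ blockIndices N v, degreeOf x P < v x.1) : IsBlockBounded N v P := fun _ hd =>
  ⟨fun _ hx => apply_eq_zero_of_mem_supported hP hd (mem_coe.not.2 hx),
    fun x hx => (monomial_le_degreeOf x (mem_support_iff.2 hd)).trans_lt (h x hx)⟩

theorem isBlockBounded_cartier {P : MvPolynomial (ℕ × ℕ) R} {ℓ : ℕ} (hℓ : 0 < ℓ)
    (hP : P ∈ supported R (blockIndices N v : Set (ℕ × ℕ)))
    (h : ∀ x ∈ blockIndices N v, degreeOf x P < ℓ * v x.1 + (ℓ - 1)) :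
    IsBlockBounded N v (cartier ℓ (blockIndices N v) P) := by
  intro d hd
  rw [coeff_cartier hℓ] at hd
  refine ⟨fun x hx => ?_, fun x hx => ?_⟩
  · have := apply_eq_zero_of_mem_supported hP hd (mem_coe.not.2 hx)
    rw [cartierExp_apply_notMem _ _ hx] at this
    exact (Nat.mul_eq_zero.1 this).resolve_left hℓ.ne'
  · have := (monomial_le_degreeOf x (mem_support_iff.2 hd)).trans_lt (h x hx)
    rw [cartierExp_apply_mem _ _ hx] at this
    exact Nat.lt_of_mul_lt_mul_left (Nat.lt_of_add_lt_add_right this)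

theorem isBlockBounded_blockVandermonde [Nontrivial R] (N : ℕ) (v : ℕ → ℕ) :
    IsBlockBounded N v (blockVandermonde R N v) := by
  refine isBlockBounded_of_degreeOf_lt (blockVandermonde_mem_supported N v) fun x hx => ?_
  have := mem_Icc.1 (mem_blockIndices.1 hx).2
  exact (degreeOf_blockVandermonde_le hx).trans_lt (by omega)

theorem isBlockAlternating_blockVandermonde (N : ℕ) (v : ℕ → ℕ) :
    IsBlockAlternating N v (blockVandermonde R N v) :=
  isBlockAlternating_of_rename (rename_blockVandermonde R N)

theorem blockVandermonde_ne_zero [IsDomain R] (N : ℕ) (v : ℕ → ℕ) :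
    blockVandermonde R N v ≠ 0 := by
  refine prod_ne_zero_iff.2 fun m _ => prod_ne_zero_iff.2 fun ij hij => sub_ne_zero.2 fun h => ?_
  have := X_injective h
  simp only [mem_filter, Prod.mk.injEq] at this hij
  omega

theorem isBlockAlternating_mul_superpotential {k n : ℕ} (hn : 2 * k ≤ n) (a b c : ℕ) (z q : R) :
    IsBlockAlternating (n - 1) (dimv k n)
      (blockVandermonde R (n - 1) (dimv k n) * superpotential k n a b c z q) := by
  refine isBlockAlternating_of_rename fun ρ => ?_
  rw [map_mul, rename_blockVandermonde, rename_superpotential hn, mul_assoc]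

theorem isBlockBounded_cartier_mul_superpotential [Nontrivial R] {k n : ℕ} (hk : 1 ≤ k)
    (hn : 2 * k ≤ n) {a b c ℓ : ℕ} (hℓ : 0 < ℓ) (ha : a + c = ℓ - 1) (hb : 2 * b + 2 * c = ℓ - 1)
    (z q : R) :
    IsBlockBounded (n - 1) (dimv k n) (cartier ℓ (blockIndices (n - 1) (dimv k n))
      (blockVandermonde R (n - 1) (dimv k n) * superpotential k n a b c z q)) := by
  refine isBlockBounded_cartier hℓ (mul_mem (blockVandermonde_mem_supported _ _)
    (superpotential_mem_supported hk hn a b c z q)) fun x hx => ?_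
  refine ((degreeOf_mul_le _ _ _).trans (add_le_add (degreeOf_blockVandermonde_le hx)
    (degreeOf_superpotential_le hk hn a b c z q hx))).trans_lt ?_
  obtain ⟨w, hw⟩ : ∃ w, dimv k n x.1 = w + 1 :=
    Nat.exists_eq_add_one.2 (by have := mem_Icc.1 (mem_blockIndices.1 hx).2; omega)
  obtain ⟨L, rfl⟩ : ∃ L, ℓ = L + 1 := Nat.exists_eq_add_one.2 hℓ
  rw [hw]
  simp only [Nat.add_sub_cancel] at ha hb ⊢
  obtain rfl : L = 2 * b + 2 * c := hb.symm
  obtain rfl : a = 2 * b + c := by omega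
  nlinarith

end Bounded

section Exponents

variable {p r₀ q₀ : ℕ}

theorem pow_add_sub_one (hp : 0 < p) (t m : ℕ) :
    p ^ (t + m) - 1 = (p ^ t - 1) + p ^ t * (p ^ m - 1) := by
  have ht := Nat.pow_pos (n := t) hp
  have hm := Nat.pow_pos (n := m) hp
  have := Nat.le_mul_of_pos_right (p ^ t) hm
  rw [pow_add, Nat.mul_sub]
  omega

theorem mul_cExp (hp : 0 < p) (hcong : p ≡ 1 [MOD q₀]) (s : ℕ) :
    q₀ * cExp p r₀ q₀ s = (p ^ s - 1) * r₀ := by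
  have h : p ^ s ≡ 1 [MOD q₀] := by simpa using hcong.pow s
  exact Nat.mul_div_cancel' (((Nat.modEq_iff_dvd' (Nat.pow_pos hp)).1 h.symm).mul_right r₀)

theorem two_mul_cExp_le (hp : 0 < p) (hq₀ : 0 < q₀) (hω : 2 * r₀ ≤ q₀)
    (hcong : p ≡ 1 [MOD q₀]) (s : ℕ) : 2 * cExp p r₀ q₀ s ≤ p ^ s - 1 := by
  refine Nat.le_of_mul_le_mul_left ?_ hq₀
  calc q₀ * (2 * cExp p r₀ q₀ s) = (p ^ s - 1) * (2 * r₀) := by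
        rw [mul_left_comm, mul_cExp hp hcong, mul_left_comm]
    _ ≤ (p ^ s - 1) * q₀ := Nat.mul_le_mul_left _ hω
    _ = q₀ * (p ^ s - 1) := mul_comm _ _

theorem cExp_add (hp : 0 < p) (hq₀ : 0 < q₀) (hcong : p ≡ 1 [MOD q₀]) (t m : ℕ) :
    cExp p r₀ q₀ (t + m) = cExp p r₀ q₀ t + p ^ t * cExp p r₀ q₀ m := by
  refine Nat.eq_of_mul_eq_mul_left hq₀ ?_
  rw [mul_add, mul_left_comm q₀, mul_cExp hp hcong, mul_cExp hp hcong, mul_cExp hp hcong,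
    pow_add_sub_one hp]
  ring

theorem aExp_add_cExp (hp : 0 < p) (hq₀ : 0 < q₀) (hω : 2 * r₀ ≤ q₀)
    (hcong : p ≡ 1 [MOD q₀]) (s : ℕ) : aExp p r₀ q₀ s + cExp p r₀ q₀ s = p ^ s - 1 := by
  have := two_mul_cExp_le hp hq₀ hω hcong s
  rw [aExp]
  omega

theorem two_mul_bExp_add_cExp (hodd : Odd p) (hq₀ : 0 < q₀) (hω : 2 * r₀ ≤ q₀)
    (hcong : p ≡ 1 [MOD q₀]) (s : ℕ) :
    2 * bExp p r₀ q₀ s + 2 * cExp p r₀ q₀ s = p ^ s - 1 := by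
  have := two_mul_cExp_le hodd.pos hq₀ hω hcong s
  obtain ⟨u, hu⟩ := hodd.pow (n := s)
  rw [bExp]
  omega

theorem aExp_add (hp : 0 < p) (hq₀ : 0 < q₀) (hω : 2 * r₀ ≤ q₀) (hcong : p ≡ 1 [MOD q₀])
    (t m : ℕ) : aExp p r₀ q₀ (t + m) = aExp p r₀ q₀ t + p ^ t * aExp p r₀ q₀ m := by
  have h := aExp_add_cExp hp hq₀ hω hcong (t + m)
  rw [pow_add_sub_one hp, ← aExp_add_cExp hp hq₀ hω hcong t, ← aExp_add_cExp hp hq₀ hω hcong m,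
    cExp_add hp hq₀ hcong] at h
  linarith

theorem bExp_add (hodd : Odd p) (hq₀ : 0 < q₀) (hω : 2 * r₀ ≤ q₀) (hcong : p ≡ 1 [MOD q₀])
    (t m : ℕ) : bExp p r₀ q₀ (t + m) = bExp p r₀ q₀ t + p ^ t * bExp p r₀ q₀ m := by
  have h := two_mul_bExp_add_cExp hodd hq₀ hω hcong (t + m)
  rw [pow_add_sub_one hodd.pos, ← two_mul_bExp_add_cExp hodd hq₀ hω hcong t,
    ← two_mul_bExp_add_cExp hodd hq₀ hω hcong m, cExp_add hodd.pos hq₀ hcong] at h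
  linarith

end Exponents

theorem expVec_apply (p k n s : ℕ) (x : ℕ × ℕ) : expVec p k n s x =
    if x ∈ blockIndices (n - 1) (dimv k n) then x.2 * p ^ s - 1 else 0 := by
  obtain ⟨m, j⟩ := x
  simp only [expVec, Finsupp.finsetSum_apply, Finsupp.single_apply, Prod.mk.injEq,
    mem_blockIndices, ite_and]
  simp only [sum_ite_irrel, sum_ite_eq', sum_const_zero]

theorem expVec_add_s2 {p : ℕ} (hp : 0 < p) (k n t m : ℕ) : expVec p k n (t + m) =
    cartierExp (p ^ t) (blockIndices (n - 1) (dimv k n)) (expVec p k n m) := by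
  ext x
  by_cases hx : x ∈ blockIndices (n - 1) (dimv k n)
  · rw [cartierExp_apply_mem _ _ hx, expVec_apply, expVec_apply, if_pos hx, if_pos hx]
    have ht := Nat.pow_pos (n := t) hp
    obtain ⟨u, hu⟩ : ∃ u, x.2 * p ^ m = u + 1 := Nat.exists_eq_add_one.2
      (Nat.mul_pos (mem_Icc.1 (mem_blockIndices.1 hx).2).1 (Nat.pow_pos hp))
    rw [pow_add, mul_left_comm, hu, Nat.add_sub_cancel, mul_add, mul_one]
    omega
  · rw [cartierExp_apply_notMem _ _ hx, expVec_apply, expVec_apply, if_neg hx, if_neg hx, mul_zero]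

theorem coeff_expVec_zero_blockVandermonde_ne_zero (R : Type*) [CommRing R] [IsDomain R]
    [CharZero R] (p k n : ℕ) :
    coeff (expVec p k n 0) (blockVandermonde R (n - 1) (dimv k n)) ≠ 0 := fun h =>
  blockVandermonde_ne_zero (n - 1) (dimv k n) <|
    (isBlockAlternating_blockVandermonde _ _).eq_zero (isBlockBounded_blockVandermonde _ _)
      (fun x hx => by rw [expVec_apply, if_neg hx])
      (fun x hx => by rw [expVec_apply, if_pos hx, pow_zero, mul_one]) h

theorem evalQ_Ts (ζ : ℂ) (e p r₀ q₀ k n s : ℕ) : evalQ ζ e (Ts p r₀ q₀ k n s) =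
    coeff (expVec p k n s) (blockVandermonde (Polynomial ℂ) (n - 1) (dimv k n) *
      superpotential k n (aExp p r₀ q₀ s) (bExp p r₀ q₀ s) (cExp p r₀ q₀ s)
        (Polynomial.X ^ e) (Polynomial.C ζ)) := by
  have hz : evalQ ζ e Zvar = Polynomial.X ^ e := by simp [evalQ, Zvar]
  have hq : evalQ ζ e Qvar = Polynomial.C ζ := by simp [evalQ, Qvar]
  rw [Ts, ← coeff_map, map_Phi, hz, hq]

/-- The truncations factor at a root of unity of order `p ^ t`, up to the nonzero constant
`coeff (expVec p k n 0) (blockVandermonde _ _ _)`. -/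
theorem mul_evalQ_Ts_add {p r₀ q₀ k n : ℕ} (hodd : Odd p) (hq₀ : 0 < q₀) (hω : 2 * r₀ ≤ q₀)
    (hcong : p ≡ 1 [MOD q₀]) (hk : 1 ≤ k) (hn : 2 * k ≤ n) {ζ : ℂ} {t : ℕ}
    (hζ : IsPrimitiveRoot ζ (p ^ t)) (m e : ℕ) :
    coeff (expVec p k n 0) (blockVandermonde (Polynomial ℂ) (n - 1) (dimv k n)) *
        evalQ ζ e (Ts p r₀ q₀ k n (t + m)) =
      evalQ ζ e (Ts p r₀ q₀ k n t) * evalQ 1 (e * p ^ t) (Ts p r₀ q₀ k n m) := by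
  have hp := hodd.pos
  have hℓ : 0 < p ^ t := Nat.pow_pos hp
  have hC : IsPrimitiveRoot (Polynomial.C ζ) (p ^ t) :=
    hζ.map_of_injective Polynomial.C_injective
  simp only [evalQ_Ts, aExp_add hp hq₀ hω hcong, bExp_add hodd hq₀ hω hcong,
    cExp_add hp hq₀ hcong, superpotential_add_mul k n hC hℓ, ← mul_assoc, expVec_add_s2 hp k n t m,
    ← coeff_cartier hℓ, cartier_mul_expand hℓ, ← pow_mul, map_one]
  have ht : expVec p k n t =
      cartierExp (p ^ t) (blockIndices (n - 1) (dimv k n)) (expVec p k n 0) :=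
    expVec_add_s2 hp k n t 0
  rw [ht, ← coeff_cartier hℓ]
  set Δ := blockVandermonde (Polynomial ℂ) (n - 1) (dimv k n)
  set E := cartier (p ^ t) (blockIndices (n - 1) (dimv k n)) (Δ * superpotential k n
    (aExp p r₀ q₀ t) (bExp p r₀ q₀ t) (cExp p r₀ q₀ t) (Polynomial.X ^ e) (Polynomial.C ζ))
  have hE : C (coeff (expVec p k n 0) Δ) * E = C (coeff (expVec p k n 0) E) * Δ := by
    refine sub_eq_zero.1 (IsBlockAlternating.eq_zero (N := n - 1) (v := dimv k n)
      (d₀ := expVec p k n 0) ?_ ?_ ?_ ?_ ?_)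
    · exact (((isBlockAlternating_mul_superpotential hn _ _ _ _ _).cartier hℓ).C_mul _).sub
        ((isBlockAlternating_blockVandermonde _ _).C_mul _)
    · exact ((isBlockBounded_cartier_mul_superpotential hk hn hℓ
        (aExp_add_cExp hp hq₀ hω hcong t) (two_mul_bExp_add_cExp hodd hq₀ hω hcong t) _ _).C_mul
          _).sub ((isBlockBounded_blockVandermonde _ _).C_mul _)
    · exact fun x hx => by rw [expVec_apply, if_neg hx]
    · exact fun x hx => by rw [expVec_apply, if_pos hx, pow_zero, mul_one]
    · rw [coeff_sub, coeff_C_mul, coeff_C_mul, mul_comm, sub_self]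
  rw [← coeff_C_mul, ← mul_assoc, hE, mul_assoc, coeff_C_mul]

/-- For `s ≥ 1` and `ζ` a nontrivial `p^s`-th root of unity, the exact identity
`T_{s+1}(z,ζ)·T_{s-1}(z^p,ζ^p) = T_s(z,ζ)·T_s(z^p,ζ^p)` holds in `ℂ[z]`. -/
theorem exact_identity_at_root_of_unity (p r₀ q₀ k n : ℕ) (hp : p.Prime) (hodd : Odd p)
    (hr₀ : 0 < r₀) (hq₀ : 0 < q₀) (hω : 2 * r₀ ≤ q₀) (hcong : p ≡ 1 [MOD q₀])
    (hk : 1 ≤ k) (hn : 2 * k ≤ n) (s : ℕ) (hs : 1 ≤ s)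
    (ζ : ℂ) (hζ : ζ ^ (p ^ s) = 1) (hζ1 : ζ ≠ 1) :
    evalQ ζ 1 (Ts p r₀ q₀ k n (s + 1)) * evalQ (ζ ^ p) p (Ts p r₀ q₀ k n (s - 1)) =
      evalQ ζ 1 (Ts p r₀ q₀ k n s) * evalQ (ζ ^ p) p (Ts p r₀ q₀ k n s) := by
  obtain ⟨t, hts, ht⟩ : ∃ t, t ≤ s ∧ orderOf ζ = p ^ t :=
    (Nat.dvd_prime_pow hp).1 (orderOf_dvd_of_pow_eq_one hζ)
  have hprim : IsPrimitiveRoot ζ (p ^ t) := ht ▸ IsPrimitiveRoot.orderOf ζ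
  obtain ⟨u, rfl⟩ : ∃ u, t = u + 1 := by
    refine Nat.exists_eq_add_one.2 (Nat.pos_of_ne_zero fun h => hζ1 ?_)
    rwa [h, pow_zero, orderOf_eq_one_iff] at ht
  obtain ⟨m, rfl⟩ := Nat.exists_eq_add_of_le hts
  have hprim' : IsPrimitiveRoot (ζ ^ p) (p ^ u) :=
    hprim.pow (Nat.pow_pos hp.pos) (pow_succ' p u)
  have hc := coeff_expVec_zero_blockVandermonde_ne_zero (Polynomial ℂ) p k n
  have h₁ := mul_evalQ_Ts_add hodd hq₀ hω hcong hk hn hprim (m + 1) 1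
  have h₂ := mul_evalQ_Ts_add hodd hq₀ hω hcong hk hn hprim' m p
  have h₃ := mul_evalQ_Ts_add hodd hq₀ hω hcong hk hn hprim m 1
  have h₄ := mul_evalQ_Ts_add hodd hq₀ hω hcong hk hn hprim' (m + 1) p
  rw [show u + 1 + m - 1 = u + m by omega]
  rw [show u + (m + 1) = u + 1 + m by omega, ← pow_succ', ← one_mul (p ^ (u + 1))] at h₄
  rw [← pow_succ', ← one_mul (p ^ (u + 1))] at h₂
  set c := coeff (expVec p k n 0) (blockVandermonde (Polynomial ℂ) (n - 1) (dimv k n))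
  refine mul_left_cancel₀ hc (mul_left_cancel₀ hc ?_)
  calc _ = (c * evalQ ζ 1 (Ts p r₀ q₀ k n (u + 1 + (m + 1)))) *
        (c * evalQ (ζ ^ p) p (Ts p r₀ q₀ k n (u + m))) := by ring_nf
    _ = (c * evalQ ζ 1 (Ts p r₀ q₀ k n (u + 1 + m))) *
        (c * evalQ (ζ ^ p) p (Ts p r₀ q₀ k n (u + 1 + m))) := by rw [h₁, h₂, h₃, h₄]; ring
    _ = _ := by ring
end
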